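/- Fix N ≥ 1, 0 < b < min{2,N}, and 1 + 4/N < p < 2* (where 2* = ∞ if N = 1,2 and 2* = 1 + (4−2b)/(N−2) if N ≥ 3); set α = N(p−1)/4, so α > 1. Let u be a classical Schwartz solution of (INLS) on an interval J, and suppose there exist constants δ₀, M₁, C₁ > 0 such that for all t ∈ J: (i) K(u(t,·)) ≤ −δ₀ ∫|∇ₓu(t,x)|² dx; (ii) ∫|u(t,x)|² dx ≤ M₁; (iii) ∫|u(t,x)|^{p+1} dx ≤ C₁ (∫|∇ₓu(t,x)|² dx)^{α}. Let C₃ > 0 and, for R > 0, let w : [0,∞) → ℝ be of class C⁴ with w(r) = r² for r ≤ R, w(r) = 0 for r ≥ 2R, w'' ≤ 2, |w''| ≤ C₃, and such that φ(x) = w(|x|) is C⁴ with |Δ²φ| ≤ C₃/R². Then there exists C > 0, depending only on N, p, b, δ₀, M₁, C₁, C₃, such that the localized virial quantity I(t) = ∫ φ|u(t,·)|² dx satisfies, for all t ∈ J, I''(t) ≤ −8δ₀ ∫|∇ₓu(t,x)|² dx + C ( R^{-b} (∫|∇ₓu(t,x)|² dx)^{α} + R^{-2} ). -/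

import Mathlib

open MeasureTheory Set
open scoped BigOperators

noncomputable section

/-- The Laplacian of a complex-valued function on `ℝ^N`, computed as the sum of the repeated
directional derivatives along the standard basis vectors. -/
def lap {N : ℕ} (f : EuclideanSpace ℝ (Fin N) → ℂ) (x : EuclideanSpace ℝ (Fin N)) : ℂ :=
  ∑ i : Fin N, fderiv ℝ (fun y => fderiv ℝ f y (EuclideanSpace.single i 1)) x
      (EuclideanSpace.single i 1)

/-- The squared euclidean norm `|∇f(x)|²` of the gradient of `f : ℝ^N → ℂ` at `x`. -/
def gradNormSq {N : ℕ} (f : EuclideanSpace ℝ (Fin N) → ℂ) (x : EuclideanSpace ℝ (Fin N)) : ℝ :=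
  ∑ i : Fin N, ‖fderiv ℝ f x (EuclideanSpace.single i 1)‖ ^ 2

/-- A classical Schwartz solution of the inhomogeneous nonlinear Schrödinger equation
`i ∂ₜ u + Δu + |x|^{-b} |u|^{p-1} u = 0` on a time interval `J`:
for each time `t` the spatial profile `u t` is a Schwartz function, `u` is jointly
continuous on `J × ℝ^N`, jointly smooth on `J × (ℝ^N \ {0})`, the Schwartz seminorms of
`u t` are bounded uniformly for `t` in compact subsets of `J`, and the equation holds for
all `t ∈ J` and `x ≠ 0`. -/
structure INLSSolution (N : ℕ) (b p : ℝ) (J : Set ℝ) where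
  u : ℝ → SchwartzMap (EuclideanSpace ℝ (Fin N)) ℂ
  cont : ContinuousOn (fun q : ℝ × EuclideanSpace ℝ (Fin N) => u q.1 q.2) (J ×ˢ univ)
  smooth : ContDiffOn ℝ (⊤ : ℕ∞) (fun q : ℝ × EuclideanSpace ℝ (Fin N) => u q.1 q.2)
      (J ×ˢ {x : EuclideanSpace ℝ (Fin N) | x ≠ 0})
  seminorm_bound : ∀ K : Set ℝ, K ⊆ J → IsCompact K → ∀ k n : ℕ,
      ∃ C : ℝ, ∀ t ∈ K, SchwartzMap.seminorm ℝ k n (u t) ≤ C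
  eqn : ∀ t ∈ J, ∀ x : EuclideanSpace ℝ (Fin N), x ≠ 0 → ∃ ut' : ℂ,
      HasDerivWithinAt (fun s => u s x) ut' J t ∧
      Complex.I * ut' + lap (fun y => u t y) x +
        ((‖x‖ ^ (-b) * ‖u t x‖ ^ (p - 1) : ℝ) : ℂ) * u t x = 0

/-- The Laplacian of a real-valued function on `ℝ^N`, computed as the sum of the repeated
directional derivatives along the standard basis vectors. -/
def lapR {N : ℕ} (f : EuclideanSpace ℝ (Fin N) → ℝ) (x : EuclideanSpace ℝ (Fin N)) : ℝ :=
  ∑ i : Fin N, fderiv ℝ (fun y => fderiv ℝ f y (EuclideanSpace.single i 1)) x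
      (EuclideanSpace.single i 1)

/-- The virial functional `K(v) = ∫|∇v|² dx − ((N(p−1)+2b)/(2(p+1))) ∫ |x|^{-b}|v|^{p+1} dx`. -/
def Kq (N : ℕ) (b p : ℝ) (v : EuclideanSpace ℝ (Fin N) → ℂ) : ℝ :=
  (∫ x : EuclideanSpace ℝ (Fin N), gradNormSq v x) -
    (((N : ℝ) * (p - 1) + 2 * b) / (2 * (p + 1))) *
      ∫ x : EuclideanSpace ℝ (Fin N), ‖x‖ ^ (-b) * ‖v x‖ ^ (p + 1)

open Filter Topology InnerProductSpace

/-- The directional derivative of `f` in the direction `v`. -/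
def pd {E F : Type*} [NormedAddCommGroup E] [NormedSpace ℝ E] [NormedAddCommGroup F]
    [NormedSpace ℝ F] (v : E) (f : E → F) (x : E) : F :=
  fderiv ℝ f x v

section DirectionalDerivative

variable {E F : Type*} [NormedAddCommGroup E] [NormedSpace ℝ E] [NormedAddCommGroup F]
    [NormedSpace ℝ F]

lemma contDiff_pd {m n : WithTop ℕ∞} (v : E) {f : E → F} (hf : ContDiff ℝ n f)
    (hmn : m + 1 ≤ n) : ContDiff ℝ m (pd v f) :=
  (hf.fderiv_right hmn).clm_apply contDiff_const

lemma hasCompactSupport_pd (v : E) {f : E → F} (hf : HasCompactSupport f) :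
    HasCompactSupport (pd v f) :=
  hf.fderiv_apply ℝ v

lemma pd_add {v : E} {f g : E → F} {x : E} (hf : DifferentiableAt ℝ f x)
    (hg : DifferentiableAt ℝ g x) :
    pd v (fun y => f y + g y) x = pd v f x + pd v g x := by
  simp [pd, fderiv_fun_add hf hg]

lemma pd_const_mul {v : E} {f : E → ℝ} {x : E} (c : ℝ) (hf : DifferentiableAt ℝ f x) :
    pd v (fun y => c * f y) x = c * pd v f x := by
  simp [pd, fderiv_const_mul hf]

lemma pd_const_mul_complex {v : E} {f : E → ℂ} {x : E} (c : ℂ) (hf : DifferentiableAt ℝ f x) :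
    pd v (fun y => c * f y) x = c * pd v f x := by
  simp [pd, fderiv_const_mul hf]

lemma pd_mul {v : E} {f g : E → ℝ} {x : E} (hf : DifferentiableAt ℝ f x)
    (hg : DifferentiableAt ℝ g x) :
    pd v (fun y => f y * g y) x = f x * pd v g x + pd v f x * g x := by
  simp [pd, fderiv_fun_mul hf hg]; ring

lemma pd_inner {v : E} {f g : E → ℂ} {x : E} (hf : DifferentiableAt ℝ f x)
    (hg : DifferentiableAt ℝ g x) :
    pd v (fun y => ⟪f y, g y⟫_ℝ) x = ⟪f x, pd v g x⟫_ℝ + ⟪pd v f x, g x⟫_ℝ :=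
  fderiv_inner_apply ℝ hf hg v

lemma pd_comm {f : E → F} (hf : ContDiff ℝ 2 f) (v w : E) (x : E) :
    pd v (pd w f) x = pd w (pd v f) x := by
  have h : ∀ a b : E, pd a (pd b f) x = fderiv ℝ (fderiv ℝ f) x a b := fun a b => by
    have h1 : DifferentiableAt ℝ (fderiv ℝ f) x :=
      (hf.fderiv_right (m := 1) (by norm_num)).differentiable (by norm_num) x
    change fderiv ℝ (fun y => fderiv ℝ f y b) x a = _
    rw [fderiv_clm_apply h1 (differentiableAt_const _)]
    simp
  rw [h, h]
  exact (hf.contDiffAt.isSymmSndFDerivAt (by simp)) v w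

variable [MeasurableSpace E] [BorelSpace E] [FiniteDimensional ℝ E]

lemma integral_pd_eq_zero {μ : Measure E} [μ.IsAddHaarMeasure] {v : E} {g : E → ℝ}
    (hg : Differentiable ℝ g) (hi : Integrable g μ) (hi' : Integrable (pd v g) μ) :
    ∫ x, pd v g x ∂μ = 0 := by
  have h := integral_mul_fderiv_eq_neg_fderiv_mul_of_integrable (𝕜 := ℝ) (μ := μ)
    (f := fun _ : E => (1 : ℝ)) (g := g) (v := v) (by simp) (by simpa using! hi')
    (by simpa using hi) (fun x _ => by fun_prop) (fun x _ => hg x)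
  simpa [pd] using h

lemma integrable_pd_and_integral_eq_zero {μ : Measure E} [μ.IsAddHaarMeasure] (v : E) {g : E → ℝ}
    (hg : ContDiff ℝ 1 g) (hc : HasCompactSupport g) :
    Integrable (pd v g) μ ∧ ∫ x, pd v g x ∂μ = 0 := by
  have h1 : Continuous (pd v g) := (contDiff_pd (m := 0) v hg (by norm_num)).continuous
  have h2 : Integrable (pd v g) μ :=
    h1.integrable_of_hasCompactSupport (hasCompactSupport_pd v hc)
  exact ⟨h2, integral_pd_eq_zero (hg.differentiable (by norm_num))
    (hg.continuous.integrable_of_hasCompactSupport hc) h2⟩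

end DirectionalDerivative

/-- The `k`-th standard basis vector of `ℝ^N`. -/
abbrev ee {N : ℕ} (k : Fin N) : EuclideanSpace ℝ (Fin N) := EuclideanSpace.single k 1

lemma lapR_eq {N : ℕ} (f : EuclideanSpace ℝ (Fin N) → ℝ) (x : EuclideanSpace ℝ (Fin N)) :
    lapR f x = ∑ k, pd (ee k) (pd (ee k) f) x := rfl

lemma lap_eq {N : ℕ} (f : EuclideanSpace ℝ (Fin N) → ℂ) (x : EuclideanSpace ℝ (Fin N)) :
    lap f x = ∑ k, pd (ee k) (pd (ee k) f) x := rfl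

lemma gradNormSq_eq {N : ℕ} (f : EuclideanSpace ℝ (Fin N) → ℂ) (x : EuclideanSpace ℝ (Fin N)) :
    gradNormSq f x = ∑ k, ‖pd (ee k) f x‖ ^ 2 := rfl

/-- The symmetrized transport operator `2∇φ·∇ + Δφ` applied to `f`. -/
def transport {N : ℕ} (φ : EuclideanSpace ℝ (Fin N) → ℝ) (f : EuclideanSpace ℝ (Fin N) → ℂ)
    (x : EuclideanSpace ℝ (Fin N)) : ℂ :=
  ∑ k, ((2 * pd (ee k) φ x) • pd (ee k) f x + (pd (ee k) (pd (ee k) φ) x) • f x)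

section StaticIdentities

variable {N : ℕ} {φ : EuclideanSpace ℝ (Fin N) → ℝ}

lemma continuous_pd {E F : Type*} [NormedAddCommGroup E] [NormedSpace ℝ E] [NormedAddCommGroup F]
    [NormedSpace ℝ F] (v : E) {f : E → F} (hf : ContDiff ℝ 1 f) : Continuous (pd v f) :=
  (contDiff_pd (m := 0) v hf (by norm_num)).continuous

lemma differentiable_pd {E F : Type*} [NormedAddCommGroup E] [NormedSpace ℝ E]
    [NormedAddCommGroup F] [NormedSpace ℝ F] (v : E) {f : E → F} (hf : ContDiff ℝ 2 f) :
    Differentiable ℝ (pd v f) :=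
  (contDiff_pd (m := 1) v hf (by norm_num)).differentiable (by norm_num)

lemma continuous_transport (hφ : ContDiff ℝ 2 φ) {f : EuclideanSpace ℝ (Fin N) → ℂ}
    (hf : ContDiff ℝ 1 f) : Continuous (transport φ f) := by
  have h1 : ∀ k : Fin N, Continuous (pd (ee k) φ) := fun k =>
    continuous_pd _ (hφ.of_le (by norm_num))
  have h2 : ∀ k : Fin N, Continuous (pd (ee k) (pd (ee k) φ)) := fun k =>
    continuous_pd _ (contDiff_pd _ hφ (by norm_num))
  have h3 : ∀ k : Fin N, Continuous (pd (ee k) f) := fun k => continuous_pd _ hf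
  have h4 := hf.continuous
  unfold transport
  fun_prop

lemma transport_eq_zero_of_notMem (f : EuclideanSpace ℝ (Fin N) → ℂ)
    {x : EuclideanSpace ℝ (Fin N)} (hx : x ∉ tsupport φ) : transport φ f x = 0 := by
  have h1 : ∀ k : Fin N, pd (ee k) φ =ᶠ[𝓝 x] 0 := fun k => by
    have : φ =ᶠ[𝓝 x] 0 := notMem_tsupport_iff_eventuallyEq.mp hx
    filter_upwards [this.eventuallyEq_nhds] with y hy
    simp [pd, hy.fderiv_eq]
  refine Finset.sum_eq_zero fun k _ => ?_
  have h2 : pd (ee k) (pd (ee k) φ) x = 0 := by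
    rw [pd, (h1 k).fderiv_eq]; simp
  rw [(h1 k).self_of_nhds, h2]; simp

lemma integrable_inner_transport (hφ : ContDiff ℝ 2 φ) (hc : HasCompactSupport φ)
    {v f : EuclideanSpace ℝ (Fin N) → ℂ} (hv : Continuous v) (hf : ContDiff ℝ 1 f) :
    Integrable fun x => ⟪v x, transport φ f x⟫_ℝ := by
  refine (hv.inner (continuous_transport hφ hf)).integrable_of_hasCompactSupport ?_
  exact HasCompactSupport.intro hc fun x hx => by
    simp [transport_eq_zero_of_notMem f hx]

/-- The operator `2∇φ·∇ + Δφ` is antisymmetric. -/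
lemma integral_inner_transport_comm (hφ : ContDiff ℝ 2 φ) (hc : HasCompactSupport φ)
    {f g : EuclideanSpace ℝ (Fin N) → ℂ} (hf : ContDiff ℝ 1 f) (hg : ContDiff ℝ 1 g) :
    ∫ x, ⟪Complex.I * f x, transport φ g x⟫_ℝ = ∫ x, ⟪Complex.I * g x, transport φ f x⟫_ℝ := by
  have hIf : ContDiff ℝ 1 fun x => Complex.I * f x := contDiff_const.mul hf
  have hIg : ContDiff ℝ 1 fun x => Complex.I * g x := contDiff_const.mul hg
  have hk : ∀ k : Fin N, ContDiff ℝ 1 (pd (ee k) φ) := fun k => contDiff_pd _ hφ (by norm_num)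
  have key : ∀ x, ⟪Complex.I * f x, transport φ g x⟫_ℝ - ⟪Complex.I * g x, transport φ f x⟫_ℝ =
      ∑ k, pd (ee k) (fun y => (2 * pd (ee k) φ y) * ⟪Complex.I * f y, g y⟫_ℝ) x := fun x => by
    simp only [transport, inner_sum, ← Finset.sum_sub_distrib]
    refine Finset.sum_congr rfl fun k _ => ?_
    have dφ := (hk k).differentiable (by norm_num) x
    have df := hf.differentiable (by norm_num) x
    have dg := hg.differentiable (by norm_num) x
    have dIf := hIf.differentiable (by norm_num) x
    rw [pd_mul (dφ.const_mul 2) (dIf.inner ℝ dg), pd_const_mul _ dφ, pd_inner dIf dg,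
      pd_const_mul_complex _ df]
    simp
    ring
  have hcd : ∀ k : Fin N, ContDiff ℝ 1
      (fun y => (2 * pd (ee k) φ y) * ⟪Complex.I * f y, g y⟫_ℝ) := fun k =>
    (contDiff_const.mul (hk k)).mul (hIf.inner ℝ hg)
  have hcs : ∀ k : Fin N, HasCompactSupport
      (fun y => (2 * pd (ee k) φ y) * ⟪Complex.I * f y, g y⟫_ℝ) := fun k =>
    ((hasCompactSupport_pd (ee k) hc).mul_left).mul_right
  rw [← sub_eq_zero, ← integral_sub (integrable_inner_transport hφ hc hIf.continuous hg)
    (integrable_inner_transport hφ hc hIg.continuous hf)]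
  simp_rw [key]
  rw [integral_finsetSum _ fun k _ => (integrable_pd_and_integral_eq_zero _ (hcd k) (hcs k)).1]
  exact Finset.sum_eq_zero fun k _ => (integrable_pd_and_integral_eq_zero _ (hcd k) (hcs k)).2

/-- The first virial identity. -/
lemma integral_weight_inner_lap (hφ : ContDiff ℝ 2 φ) (hc : HasCompactSupport φ)
    {f : EuclideanSpace ℝ (Fin N) → ℂ} (hf : ContDiff ℝ 2 f) :
    ∫ x, φ x * (2 * ⟪f x, Complex.I * lap f x⟫_ℝ) =
      ∫ x, ⟪Complex.I * f x, transport φ f x⟫_ℝ := by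
  have hf1 : ContDiff ℝ 1 f := hf.of_le (by norm_num)
  have hk : ∀ k : Fin N, ContDiff ℝ 1 (pd (ee k) f) := fun k => contDiff_pd _ hf (by norm_num)
  have hIf : Continuous fun x => Complex.I * f x := continuous_const.mul hf.continuous
  have hIk : ∀ k : Fin N, ContDiff ℝ 1 (fun x => Complex.I * pd (ee k) f x) := fun k =>
    contDiff_const.mul (hk k)
  have key : ∀ x, φ x * (2 * ⟪f x, Complex.I * lap f x⟫_ℝ) =
      ⟪Complex.I * f x, transport φ f x⟫_ℝ +
      ∑ k, pd (ee k) (fun y => (2 * φ y) * ⟪f y, Complex.I * pd (ee k) f y⟫_ℝ) x := fun x => by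
    simp only [transport, lap_eq, inner_sum, Finset.mul_sum, ← Finset.sum_add_distrib]
    refine Finset.sum_congr rfl fun k _ => ?_
    have dφ := hφ.differentiable (by norm_num) x
    have df := hf.differentiable (by norm_num) x
    have dk := (hk k).differentiable (by norm_num) x
    have dIk := (hIk k).differentiable (by norm_num) x
    rw [pd_mul (dφ.const_mul 2) (df.inner ℝ dIk), pd_const_mul _ dφ, pd_inner df dIk,
      pd_const_mul_complex _ dk]
    simp
    ring
  have hcd : ∀ k : Fin N, ContDiff ℝ 1
      (fun y => (2 * φ y) * ⟪f y, Complex.I * pd (ee k) f y⟫_ℝ) := fun k =>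
    (contDiff_const.mul (hφ.of_le (by norm_num))).mul (hf1.inner ℝ (hIk k))
  have hcs : ∀ k : Fin N, HasCompactSupport
      (fun y => (2 * φ y) * ⟪f y, Complex.I * pd (ee k) f y⟫_ℝ) := fun k =>
    (hc.mul_left).mul_right
  simp_rw [key]
  rw [integral_add (integrable_inner_transport hφ hc hIf hf1)
    (integrable_finsetSum _ fun k _ => (integrable_pd_and_integral_eq_zero _ (hcd k) (hcs k)).1),
    integral_finsetSum _ fun k _ => (integrable_pd_and_integral_eq_zero _ (hcd k) (hcs k)).1,
    Finset.sum_eq_zero fun k _ => (integrable_pd_and_integral_eq_zero _ (hcd k) (hcs k)).2,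
    add_zero]

lemma lapR_lapR_eq (hφ : ContDiff ℝ 4 φ) (x : EuclideanSpace ℝ (Fin N)) :
    lapR (lapR φ) x =
      ∑ j, ∑ k, pd (ee j) (pd (ee j) (pd (ee k) (pd (ee k) φ))) x := by
  have hkk : ∀ k : Fin N, ContDiff ℝ 2 (pd (ee k) (pd (ee k) φ)) := fun k =>
    contDiff_pd (n := 3) _ (contDiff_pd _ hφ (by norm_num)) (by norm_num)
  have h1 : ∀ j : Fin N, pd (ee j) (lapR φ) = fun y =>
      ∑ k, pd (ee j) (pd (ee k) (pd (ee k) φ)) y := fun j => by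
    ext y
    change fderiv ℝ (fun z => ∑ k, pd (ee k) (pd (ee k) φ) z) y (ee j) = _
    rw [fderiv_fun_sum fun k _ => (hkk k).differentiable (by norm_num) y]
    simp [pd]
  rw [lapR_eq]
  refine Finset.sum_congr rfl fun j _ => ?_
  rw [h1]
  change fderiv ℝ (fun z => ∑ k, pd (ee j) (pd (ee k) (pd (ee k) φ)) z) x (ee j) = _
  rw [fderiv_fun_sum fun k _ => differentiable_pd _ (hkk k) x]
  simp [pd]

/-- The second virial identity, linear part. -/
lemma integral_inner_lap_transport (hφ : ContDiff ℝ 4 φ) (hc : HasCompactSupport φ)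
    {f : EuclideanSpace ℝ (Fin N) → ℂ} (hf : ContDiff ℝ 3 f) :
    -2 * ∫ x, ⟪lap f x, transport φ f x⟫_ℝ =
      ∫ x, (4 * ∑ j, ∑ k, pd (ee j) (pd (ee k) φ) x * ⟪pd (ee j) f x, pd (ee k) f x⟫_ℝ
        - lapR (lapR φ) x * ‖f x‖ ^ 2) := by
  have hf1 : ContDiff ℝ 1 f := hf.of_le (by norm_num)
  have hf2 : ContDiff ℝ 2 f := hf.of_le (by norm_num)
  have hk : ∀ k : Fin N, ContDiff ℝ 1 (pd (ee k) f) := fun k => contDiff_pd _ hf2 (by norm_num)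
  have pk : ∀ k : Fin N, ContDiff ℝ 3 (pd (ee k) φ) := fun k => contDiff_pd _ hφ (by norm_num)
  have pkk : ∀ j k : Fin N, ContDiff ℝ 2 (pd (ee j) (pd (ee k) φ)) := fun j k =>
    contDiff_pd _ (pk k) (by norm_num)
  have pkkj : ∀ j k : Fin N, ContDiff ℝ 1 (pd (ee j) (pd (ee k) (pd (ee k) φ))) := fun j k =>
    contDiff_pd _ (pkk k k) (by norm_num)
  let G : Fin N → Fin N → EuclideanSpace ℝ (Fin N) → ℝ := fun j k y =>
    (-4) * (pd (ee k) φ y * ⟪pd (ee j) f y, pd (ee k) f y⟫_ℝ) +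
      ((-2) * (pd (ee k) (pd (ee k) φ) y * ⟪pd (ee j) f y, f y⟫_ℝ) +
      pd (ee j) (pd (ee k) (pd (ee k) φ)) y * ⟪f y, f y⟫_ℝ)
  let H : Fin N → Fin N → EuclideanSpace ℝ (Fin N) → ℝ := fun j k y =>
    2 * (pd (ee k) φ y * ⟪pd (ee j) f y, pd (ee j) f y⟫_ℝ)
  have hG : ∀ j k, ContDiff ℝ 1 (G j k) := fun j k =>
    (contDiff_const.mul (((pk k).of_le (by norm_num)).mul ((hk j).inner ℝ (hk k)))).add
      ((contDiff_const.mul (((pkk k k).of_le (by norm_num)).mul ((hk j).inner ℝ hf1))).add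
        ((pkkj j k).mul (hf1.inner ℝ hf1)))
  have hH : ∀ j k, ContDiff ℝ 1 (H j k) := fun j k =>
    contDiff_const.mul (((pk k).of_le (by norm_num)).mul ((hk j).inner ℝ (hk j)))
  have ck : ∀ k : Fin N, HasCompactSupport (pd (ee k) φ) := fun k => hasCompactSupport_pd _ hc
  have ckk : ∀ j k : Fin N, HasCompactSupport (pd (ee j) (pd (ee k) φ)) := fun j k =>
    hasCompactSupport_pd _ (ck k)
  have ckkj : ∀ j k : Fin N, HasCompactSupport (pd (ee j) (pd (ee k) (pd (ee k) φ))) :=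
    fun j k => hasCompactSupport_pd _ (ckk k k)
  have hcG : ∀ j k, HasCompactSupport (G j k) := fun j k =>
    ((ck k).mul_right.mul_left).add (((ckk k k).mul_right.mul_left).add (ckkj j k).mul_right)
  have hcH : ∀ j k, HasCompactSupport (H j k) := fun j k => (ck k).mul_right.mul_left
  have key : ∀ x, -2 * ⟪lap f x, transport φ f x⟫_ℝ =
      (4 * ∑ j, ∑ k, pd (ee j) (pd (ee k) φ) x * ⟪pd (ee j) f x, pd (ee k) f x⟫_ℝ
        - lapR (lapR φ) x * ‖f x‖ ^ 2) +
      ∑ j, ∑ k, (pd (ee j) (G j k) x + pd (ee k) (H j k) x) := fun x => by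
    simp only [transport, lap_eq, lapR_lapR_eq hφ, inner_sum, sum_inner, Finset.mul_sum,
      Finset.sum_mul]
    rw [Finset.sum_comm]
    simp only [← Finset.sum_add_distrib, ← Finset.sum_sub_distrib]
    refine Finset.sum_congr rfl fun j _ => Finset.sum_congr rfl fun k _ => ?_
    have dk := fun k => (pk k).differentiable (by norm_num) x
    have dkk := fun k => (pkk k k).differentiable (by norm_num) x
    have dkkj := fun j k => (pkkj j k).differentiable (by norm_num) x
    have df := hf.differentiable (by norm_num) x
    have dfk := fun k => (hk k).differentiable (by norm_num) x
    have e1 : pd (ee j) (G j k) x = _ := pd_add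
      (((dk k).fun_mul ((dfk j).inner ℝ (dfk k))).const_mul (-4))
      ((((dkk k).fun_mul ((dfk j).inner ℝ df)).const_mul (-2)).add
        ((dkkj j k).fun_mul (df.inner ℝ df)))
    rw [e1, pd_const_mul _ ((dk k).fun_mul ((dfk j).inner ℝ (dfk k))),
      pd_mul (dk k) ((dfk j).inner ℝ (dfk k)), pd_inner (dfk j) (dfk k),
      pd_add (((dkk k).fun_mul ((dfk j).inner ℝ df)).const_mul (-2))
        ((dkkj j k).fun_mul (df.inner ℝ df)),
      pd_const_mul _ ((dkk k).fun_mul ((dfk j).inner ℝ df)),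
      pd_mul (dkk k) ((dfk j).inner ℝ df), pd_inner (dfk j) df,
      pd_mul (dkkj j k) (df.inner ℝ df), pd_inner df df,
      pd_const_mul _ ((dk k).fun_mul ((dfk j).inner ℝ (dfk j))),
      pd_mul (dk k) ((dfk j).inner ℝ (dfk j)), pd_inner (dfk j) (dfk j),
      pd_comm hf2 (ee k) (ee j), ← real_inner_self_eq_norm_sq]
    simp
    ring
  have hI : ∀ j k, Integrable (fun x => pd (ee j) (G j k) x + pd (ee k) (H j k) x) :=
    fun j k => (integrable_pd_and_integral_eq_zero _ (hG j k) (hcG j k)).1.add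
      (integrable_pd_and_integral_eq_zero _ (hH j k) (hcH j k)).1
  have hz : ∫ x, ∑ j, ∑ k, (pd (ee j) (G j k) x + pd (ee k) (H j k) x) = 0 := by
    rw [integral_finsetSum _ fun j _ => integrable_finsetSum _ fun k _ => hI j k]
    refine Finset.sum_eq_zero fun j _ => ?_
    rw [integral_finsetSum _ fun k _ => hI j k]
    refine Finset.sum_eq_zero fun k _ => ?_
    rw [integral_add (integrable_pd_and_integral_eq_zero _ (hG j k) (hcG j k)).1
      (integrable_pd_and_integral_eq_zero _ (hH j k) (hcH j k)).1,
      (integrable_pd_and_integral_eq_zero _ (hG j k) (hcG j k)).2,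
      (integrable_pd_and_integral_eq_zero _ (hH j k) (hcH j k)).2, add_zero]
  have hIs : Integrable fun x => ∑ j, ∑ k, (pd (ee j) (G j k) x + pd (ee k) (H j k) x) :=
    integrable_finsetSum _ fun j _ => integrable_finsetSum _ fun k _ => hI j k
  have hlap : Continuous (lap f) := by
    have : ∀ k : Fin N, Continuous (pd (ee k) (pd (ee k) f)) := fun k => continuous_pd _ (hk k)
    change Continuous fun x => ∑ k, pd (ee k) (pd (ee k) f) x
    fun_prop
  have hIl := (integrable_inner_transport (hφ.of_le (by norm_num)) hc hlap hf1).const_mul (-2)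
  rw [← integral_const_mul, ← sub_zero (∫ x, (-2) * _), ← hz, ← integral_sub hIl hIs]
  congr 1; ext x
  rw [key x]; ring

end StaticIdentities

section Radial

variable {N : ℕ}

lemma hasFDerivAt_norm_of_ne_zero {E : Type*} [NormedAddCommGroup E] [InnerProductSpace ℝ E]
    {x : E} (hx : x ≠ 0) : HasFDerivAt (fun y : E => ‖y‖) (‖x‖⁻¹ • innerSL ℝ x) x := by
  have h := ((hasStrictFDerivAt_norm_sq x).hasFDerivAt).sqrt (by positivity)
  simp only [Real.sqrt_sq (norm_nonneg _)] at h
  convert! h using 1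
  ext v
  simp
  field_simp

/-- Directional derivatives of a radial function away from the origin. -/
lemma pd_comp_norm {g : ℝ → ℝ} {x : EuclideanSpace ℝ (Fin N)} (hx : x ≠ 0)
    (hg : DifferentiableAt ℝ g ‖x‖) (k : Fin N) :
    pd (ee k) (fun y => g ‖y‖) x = deriv g ‖x‖ / ‖x‖ * x k := by
  have h := hg.hasDerivAt.comp_hasFDerivAt x (hasFDerivAt_norm_of_ne_zero hx)
  rw [pd]
  erw [h.fderiv]
  simp [EuclideanSpace.inner_single_right]
  ring

lemma differentiableAt_comp_norm {g : ℝ → ℝ} {x : EuclideanSpace ℝ (Fin N)} (hx : x ≠ 0)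
    (hg : DifferentiableAt ℝ g ‖x‖) : DifferentiableAt ℝ (fun y => g ‖y‖) x :=
  (hg.hasDerivAt.comp_hasFDerivAt x (hasFDerivAt_norm_of_ne_zero hx)).differentiableAt

lemma pd_coord (j k : Fin N) (x : EuclideanSpace ℝ (Fin N)) :
    pd (ee j) (fun y : EuclideanSpace ℝ (Fin N) => y k) x = if j = k then 1 else 0 := by
  have h : HasFDerivAt (fun y : EuclideanSpace ℝ (Fin N) => y k)
      (EuclideanSpace.proj k : EuclideanSpace ℝ (Fin N) →L[ℝ] ℝ) x :=
    (EuclideanSpace.proj k : EuclideanSpace ℝ (Fin N) →L[ℝ] ℝ).hasFDerivAt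
  rw [pd, h.fderiv]
  simp [eq_comm]

/-- The Hessian of a radial function away from the origin. -/
lemma pd_pd_comp_norm {w : ℝ → ℝ} (hw : ContDiff ℝ 2 w) {x : EuclideanSpace ℝ (Fin N)}
    (hx : x ≠ 0) (j k : Fin N) :
    pd (ee j) (pd (ee k) (fun y => w ‖y‖)) x =
      deriv w ‖x‖ / ‖x‖ * (if j = k then 1 else 0) +
      (deriv (deriv w) ‖x‖ - deriv w ‖x‖ / ‖x‖) * (x j * x k) / ‖x‖ ^ 2 := by
  have hx' : ‖x‖ ≠ 0 := by simpa using hx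
  have hd : Differentiable ℝ (deriv w) :=
    (hw.deriv' (n := 1)).differentiable (by norm_num)
  have e : pd (ee k) (fun y => w ‖y‖) =ᶠ[𝓝 x] fun y => (deriv w ‖y‖ / ‖y‖) * y k := by
    filter_upwards [isOpen_ne.mem_nhds hx] with y hy
    exact pd_comp_norm hy (hw.differentiable (by norm_num) _) k
  have hq : HasDerivAt (fun r => deriv w r / r)
      ((deriv (deriv w) ‖x‖ * ‖x‖ - deriv w ‖x‖ * 1) / ‖x‖ ^ 2) ‖x‖ :=
    (hd ‖x‖).hasDerivAt.div (hasDerivAt_id _) hx'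
  have d1 : DifferentiableAt ℝ (fun y : EuclideanSpace ℝ (Fin N) => deriv w ‖y‖ / ‖y‖) x :=
    differentiableAt_comp_norm (g := fun r => deriv w r / r) hx hq.differentiableAt
  have d2 : DifferentiableAt ℝ (fun y : EuclideanSpace ℝ (Fin N) => y k) x := by fun_prop
  have e2 : pd (ee j) (pd (ee k) (fun y => w ‖y‖)) x =
      pd (ee j) (fun y => (deriv w ‖y‖ / ‖y‖) * y k) x := by
    rw [pd, e.fderiv_eq, pd]
  rw [e2, pd_mul d1 d2, pd_coord,
    pd_comp_norm (g := fun r => deriv w r / r) hx hq.differentiableAt, hq.deriv]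
  field_simp

lemma sum_coord_sq (x : EuclideanSpace ℝ (Fin N)) : ∑ k, x k * x k = ‖x‖ ^ 2 := by
  rw [EuclideanSpace.norm_sq_eq]
  simp [sq]

lemma lapR_comp_norm {w : ℝ → ℝ} (hw : ContDiff ℝ 2 w) {x : EuclideanSpace ℝ (Fin N)}
    (hx : x ≠ 0) :
    lapR (fun y => w ‖y‖) x =
      deriv (deriv w) ‖x‖ + ((N : ℝ) - 1) * (deriv w ‖x‖ / ‖x‖) := by
  have hx' : ‖x‖ ≠ 0 := by simpa using hx
  rw [lapR_eq]
  simp_rw [pd_pd_comp_norm hw hx]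
  rw [Finset.sum_add_distrib, ← Finset.sum_div, ← Finset.mul_sum, ← Finset.mul_sum, sum_coord_sq]
  simp
  field_simp
  ring

lemma sum_coord_mul_pd_comp_norm {w : ℝ → ℝ} (hw : Differentiable ℝ w)
    {x : EuclideanSpace ℝ (Fin N)} (hx : x ≠ 0) :
    ∑ k, x k * pd (ee k) (fun y => w ‖y‖) x = deriv w ‖x‖ * ‖x‖ := by
  have hx' : ‖x‖ ≠ 0 := by simpa using hx
  simp_rw [pd_comp_norm hx (hw _)]
  have : ∀ k, x k * (deriv w ‖x‖ / ‖x‖ * x k) = deriv w ‖x‖ / ‖x‖ * (x k * x k) := fun k => by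
    ring
  simp_rw [this]
  rw [← Finset.mul_sum, sum_coord_sq]
  field_simp

lemma norm_sum_coord_smul_sq_le (x : EuclideanSpace ℝ (Fin N)) (a : Fin N → ℂ) :
    ‖∑ k, x k • a k‖ ^ 2 ≤ ‖x‖ ^ 2 * ∑ k, ‖a k‖ ^ 2 := by
  calc ‖∑ k, x k • a k‖ ^ 2 ≤ (∑ k, |x k| * ‖a k‖) ^ 2 := by
        gcongr
        refine (norm_sum_le _ _).trans (le_of_eq ?_)
        simp
    _ ≤ (∑ k, |x k| ^ 2) * ∑ k, ‖a k‖ ^ 2 := Finset.sum_mul_sq_le_sq_mul_sq _ _ _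
    _ = ‖x‖ ^ 2 * ∑ k, ‖a k‖ ^ 2 := by rw [EuclideanSpace.norm_sq_eq]; simp

lemma hessian_comp_norm_le {w : ℝ → ℝ} (hw : ContDiff ℝ 2 w) {x : EuclideanSpace ℝ (Fin N)}
    (hx : x ≠ 0) (h1 : deriv w ‖x‖ ≤ 2 * ‖x‖) (h2 : deriv (deriv w) ‖x‖ ≤ 2)
    (a : Fin N → ℂ) :
    ∑ j, ∑ k, pd (ee j) (pd (ee k) (fun y => w ‖y‖)) x * ⟪a j, a k⟫_ℝ ≤ 2 * ∑ k, ‖a k‖ ^ 2 := by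
  have hx' : 0 < ‖x‖ := by simpa using hx
  set q := deriv w ‖x‖ / ‖x‖ with hq
  set S := ∑ k, ‖a k‖ ^ 2
  set T := ‖∑ k, x k • a k‖ ^ 2 with hT
  have hT' : T = ∑ j, ∑ k, (x j * x k) * ⟪a j, a k⟫_ℝ := by
    rw [hT, ← real_inner_self_eq_norm_sq]
    simp only [sum_inner, inner_sum, real_inner_smul_left, real_inner_smul_right]
    refine Finset.sum_congr rfl fun j _ => Finset.sum_congr rfl fun k _ => ?_
    rw [real_inner_comm (a j)]; ring
  have e : ∑ j, ∑ k, pd (ee j) (pd (ee k) (fun y => w ‖y‖)) x * ⟪a j, a k⟫_ℝ =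
      q * S + (deriv (deriv w) ‖x‖ - q) / ‖x‖ ^ 2 * T := by
    simp_rw [pd_pd_comp_norm hw hx, add_mul, Finset.sum_add_distrib, hT']
    congr 1
    · rw [Finset.mul_sum]
      refine Finset.sum_congr rfl fun j _ => ?_
      simp only [mul_ite, mul_one, mul_zero, ite_mul, zero_mul, Finset.sum_ite_eq,
        Finset.mem_univ, if_true, real_inner_self_eq_norm_sq, hq]
    · simp_rw [Finset.mul_sum]
      refine Finset.sum_congr rfl fun j _ => Finset.sum_congr rfl fun k _ => ?_
      rw [hq]; ring
  have hTS : T ≤ ‖x‖ ^ 2 * S := norm_sum_coord_smul_sq_le x a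
  have hq2 : q ≤ 2 := by rw [hq, div_le_iff₀ hx']; exact h1
  have hT0 : 0 ≤ T / ‖x‖ ^ 2 := by positivity
  have hTS' : T / ‖x‖ ^ 2 ≤ S := by rw [div_le_iff₀ (by positivity)]; linarith
  rw [e]
  have : (deriv (deriv w) ‖x‖ - q) / ‖x‖ ^ 2 * T =
      (deriv (deriv w) ‖x‖ - q) * (T / ‖x‖ ^ 2) := by ring
  rw [this]
  nlinarith [mul_nonneg hT0 (sub_nonneg.2 h2), mul_nonneg (sub_nonneg.2 hq2)
    (sub_nonneg.2 hTS')]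

end Radial

section CutoffProfile

variable {w : ℝ → ℝ} {R C : ℝ}

lemma deriv_eq_of_eq_sq (hwr : ∀ r ∈ Icc (0 : ℝ) R, w r = r ^ 2) {r : ℝ}
    (hr : r ∈ Ioo 0 R) : deriv w r = 2 * r ∧ deriv (deriv w) r = 2 := by
  have h1 : ∀ s ∈ Ioo 0 R, deriv w s = 2 * s := fun s hs => by
    have : w =ᶠ[𝓝 s] fun r => r ^ 2 := by
      filter_upwards [isOpen_Ioo.mem_nhds hs] with y hy
      exact hwr y ⟨hy.1.le, hy.2.le⟩
    rw [this.deriv_eq]; simp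
  refine ⟨h1 r hr, ?_⟩
  have : deriv w =ᶠ[𝓝 r] fun r => 2 * r := by
    filter_upwards [isOpen_Ioo.mem_nhds hr] with y hy
    exact h1 y hy
  rw [this.deriv_eq, deriv_const_mul _ differentiableAt_id]; simp

lemma deriv_zero_of_eq_sq (hR : 0 < R) (hw : ContDiff ℝ 2 w)
    (hwr : ∀ r ∈ Icc (0 : ℝ) R, w r = r ^ 2) : deriv w 0 = 0 := by
  have hc : Continuous (deriv w) := (hw.deriv' (n := 1)).continuous
  have h1 : Tendsto (deriv w) (𝓝[>] 0) (𝓝 (deriv w 0)) :=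
    (hc.tendsto 0).mono_left nhdsWithin_le_nhds
  have h2 : Tendsto (fun r : ℝ => 2 * r) (𝓝[>] 0) (𝓝 (2 * 0)) :=
    ((continuous_const.mul continuous_id).tendsto 0).mono_left nhdsWithin_le_nhds
  rw [mul_zero] at h2
  refine tendsto_nhds_unique h1 (h2.congr' ?_)
  filter_upwards [Ioo_mem_nhdsGT hR] with r hr
  exact (deriv_eq_of_eq_sq hwr hr).1.symm

lemma deriv_le_of_deriv_deriv_le (hw : ContDiff ℝ 2 w) (h0 : deriv w 0 = 0) {c : ℝ}
    (h2 : ∀ r, 0 ≤ r → deriv (deriv w) r ≤ c) {r : ℝ} (hr : 0 ≤ r) : deriv w r ≤ c * r := by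
  have hd : Differentiable ℝ (deriv w) := (hw.deriv' (n := 1)).differentiable (by norm_num)
  have := (convex_Ici (0 : ℝ)).image_sub_le_mul_sub_of_deriv_le (f := deriv w)
    hd.continuous.continuousOn hd.differentiableOn
    (fun x hx => h2 x (interior_subset hx)) 0 (by simp) r hr hr
  simpa [h0] using this

lemma abs_deriv_le (hw : ContDiff ℝ 2 w) (h0 : deriv w 0 = 0)
    (h2 : ∀ r, 0 ≤ r → |deriv (deriv w) r| ≤ C) {r : ℝ} (hr : 0 ≤ r) :
    |deriv w r| ≤ C * r := by
  have hd : Differentiable ℝ (deriv w) := (hw.deriv' (n := 1)).differentiable (by norm_num)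
  have := (convex_Ici (0 : ℝ)).norm_image_sub_le_of_norm_deriv_le (f := deriv w)
    (fun x _ => hd x) (fun x hx => h2 x hx) (x := 0) (mem_Ici.2 le_rfl) (y := r) (mem_Ici.2 hr)
  simpa [h0, abs_of_nonneg hr] using this

end CutoffProfile

section Nonlinear

variable {N : ℕ} {φ : EuclideanSpace ℝ (Fin N) → ℝ} {f : EuclideanSpace ℝ (Fin N) → ℂ}
  {b p A L : ℝ}

lemma pd_norm_rpow {q : ℝ} (hq : 1 < q) (hf : Differentiable ℝ f)
    (v x : EuclideanSpace ℝ (Fin N)) :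
    pd v (fun y => ‖f y‖ ^ q) x = q * ‖f x‖ ^ (q - 2) * ⟪f x, pd v f x⟫_ℝ := by
  have h := (hasFDerivAt_norm_rpow (f x) hq).comp x (hf x).hasFDerivAt
  rw [pd]
  erw [h.fderiv]
  simp [pd]

lemma differentiable_norm_rpow_comp {q : ℝ} (hq : 1 < q) (hf : Differentiable ℝ f) :
    Differentiable ℝ fun y => ‖f y‖ ^ q := fun x =>
  ((hasFDerivAt_norm_rpow (f x) hq).comp x (hf x).hasFDerivAt).differentiableAt

/-- The singular potential is bounded when the profile vanishes at the origin. -/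
lemma singular_potential_le (hb : 0 < b) (hbp : b < p - 1) (hL : ∀ x, ‖f x‖ ≤ L * ‖x‖)
    (hA : ∀ x, ‖f x‖ ≤ A) (x : EuclideanSpace ℝ (Fin N)) :
    ‖x‖ ^ (-b) * ‖f x‖ ^ (p - 1) ≤ |L| ^ b * A ^ (p - 1 - b) := by
  have hA0 : 0 ≤ A := (norm_nonneg _).trans (hA x)
  rcases eq_or_ne x 0 with rfl | hx
  · rw [norm_zero, Real.zero_rpow (by linarith), zero_mul]
    positivity
  have hx' : 0 < ‖x‖ := by simpa using hx
  have h1 : ‖f x‖ ^ (p - 1) = ‖f x‖ ^ b * ‖f x‖ ^ (p - 1 - b) := by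
    rw [← Real.rpow_add_of_nonneg (norm_nonneg _) hb.le (by linarith)]; congr 1; ring
  have h2 : ‖f x‖ ^ b ≤ |L| ^ b * ‖x‖ ^ b := by
    rw [← Real.mul_rpow (abs_nonneg _) (norm_nonneg _)]
    exact Real.rpow_le_rpow (norm_nonneg _)
      ((hL x).trans (mul_le_mul_of_nonneg_right (le_abs_self _) (norm_nonneg _))) hb.le
  have h3 : ‖f x‖ ^ (p - 1 - b) ≤ A ^ (p - 1 - b) :=
    Real.rpow_le_rpow (norm_nonneg _) (hA x) (by linarith)
  calc ‖x‖ ^ (-b) * ‖f x‖ ^ (p - 1)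
      ≤ ‖x‖ ^ (-b) * ((|L| ^ b * ‖x‖ ^ b) * A ^ (p - 1 - b)) := by
        rw [h1]; gcongr
    _ = |L| ^ b * A ^ (p - 1 - b) * (‖x‖ ^ (-b) * ‖x‖ ^ b) := by ring
    _ = |L| ^ b * A ^ (p - 1 - b) := by
        rw [← Real.rpow_add hx']; simp

lemma singular_potential_nonneg (x : EuclideanSpace ℝ (Fin N)) :
    0 ≤ ‖x‖ ^ (-b) * ‖f x‖ ^ (p - 1) := by positivity

lemma rpow_add_one_eq (hp : 1 < p) {r : ℝ} (hr : 0 ≤ r) : r ^ (p + 1) = r ^ (p - 1) * r ^ 2 := by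
  rw [← Real.rpow_natCast, ← Real.rpow_add_of_nonneg hr (by linarith) (by norm_num)]
  congr 1; push_cast; ring

lemma differentiable_singular_mul (hb : 0 < b) (hbp : b < p - 1)
    (hf : Differentiable ℝ f) (hL : ∀ x, ‖f x‖ ≤ L * ‖x‖) (hA : ∀ x, ‖f x‖ ≤ A)
    {ψ : EuclideanSpace ℝ (Fin N) → ℝ} (hψ : Differentiable ℝ ψ) :
    Differentiable ℝ fun x => ‖x‖ ^ (-b) * ‖f x‖ ^ (p + 1) * ψ x := fun x => by
  rcases eq_or_ne x 0 with rfl | hx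
  · have hO : (fun x => ‖x‖ ^ (-b) * ‖f x‖ ^ (p + 1) * ψ x) =O[𝓝 0]
        fun x : EuclideanSpace ℝ (Fin N) => ‖x - 0‖ ^ 2 := by
      have h1 : (fun x => ‖x‖ ^ (-b) * ‖f x‖ ^ (p + 1)) =O[𝓝 0]
          fun x : EuclideanSpace ℝ (Fin N) => ‖x - 0‖ ^ 2 := by
        refine Asymptotics.IsBigO.of_bound (|L| ^ b * A ^ (p - 1 - b) * L ^ 2)
          (Eventually.of_forall fun x => ?_)
        have hA0 : 0 ≤ A := (norm_nonneg _).trans (hA x)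
        rw [Real.norm_of_nonneg (by positivity), sub_zero, Real.norm_of_nonneg (by positivity),
          rpow_add_one_eq (by linarith) (norm_nonneg _), ← mul_assoc, mul_assoc _ (L ^ 2),
          ← mul_pow]
        exact mul_le_mul (singular_potential_le hb hbp hL hA x)
          (pow_le_pow_left₀ (norm_nonneg _) (hL x) 2) (by positivity) (by positivity)
      have h2 : ψ =O[𝓝 0] fun _ : EuclideanSpace ℝ (Fin N) => (1 : ℝ) :=
        (hψ.continuous.tendsto 0).isBigO_one ℝ
      simpa using h1.mul h2
    exact (hO.hasFDerivAt (by norm_num)).differentiableAt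
  · have hx' : 0 < ‖x‖ := by simpa using hx
    have d1 : DifferentiableAt ℝ (fun y : EuclideanSpace ℝ (Fin N) => ‖y‖ ^ (-b)) x :=
      differentiableAt_comp_norm (g := fun r => r ^ (-b)) hx
        (Real.differentiableAt_rpow_const_of_ne _ hx'.ne')
    exact (d1.fun_mul (differentiable_norm_rpow_comp (by linarith) hf x)).fun_mul (hψ x)

lemma pd_singular_mul (hp : 1 < p) (hf : Differentiable ℝ f)
    {ψ : EuclideanSpace ℝ (Fin N) → ℝ} (hψ : Differentiable ℝ ψ)
    {x : EuclideanSpace ℝ (Fin N)} (hx : x ≠ 0) (k : Fin N) :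
    pd (ee k) (fun x => ‖x‖ ^ (-b) * ‖f x‖ ^ (p + 1) * ψ x) x =
      ‖x‖ ^ (-b) * ‖f x‖ ^ (p - 1) * ((p + 1) * ⟪f x, pd (ee k) f x⟫_ℝ * ψ x +
        ‖f x‖ ^ 2 * pd (ee k) ψ x - b * ((‖f x‖ / ‖x‖) ^ 2 * (x k * ψ x))) := by
  have hx' : 0 < ‖x‖ := by simpa using hx
  have hd : DifferentiableAt ℝ (fun r : ℝ => r ^ (-b)) ‖x‖ :=
    Real.differentiableAt_rpow_const_of_ne _ hx'.ne'
  have d1 : DifferentiableAt ℝ (fun y : EuclideanSpace ℝ (Fin N) => ‖y‖ ^ (-b)) x :=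
    differentiableAt_comp_norm (g := fun r => r ^ (-b)) hx hd
  have d2 := differentiable_norm_rpow_comp (q := p + 1) (by linarith) hf x
  rw [pd_mul (d1.fun_mul d2) (hψ x), pd_mul d1 d2, pd_norm_rpow (by linarith) hf,
    pd_comp_norm (g := fun r => r ^ (-b)) hx hd, Real.deriv_rpow_const,
    rpow_add_one_eq hp (norm_nonneg _), show p + 1 - 2 = p - 1 by ring,
    Real.rpow_sub_one hx'.ne']
  field_simp
  ring

/-- The weight multiplying `|x|^{-b}|u|^{p+1}` in the second virial identity. -/
def virialWeight (b p : ℝ) (φ : EuclideanSpace ℝ (Fin N) → ℝ) (x : EuclideanSpace ℝ (Fin N)) : ℝ :=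
  -(4 * b / (p + 1)) * ((∑ k, x k * pd (ee k) φ x) / ‖x‖ ^ 2) + (4 / (p + 1) - 2) * lapR φ x

lemma measurable_singular_potential (hf : Continuous f) (b q : ℝ) :
    Measurable fun x : EuclideanSpace ℝ (Fin N) => ‖x‖ ^ (-b) * ‖f x‖ ^ q :=
  (measurable_norm.pow_const _).mul (hf.measurable.norm.pow_const _)

/-- The second virial identity, nonlinear part. -/
lemma integral_singular_inner_transport [NeZero N] (hb : 0 < b) (hbp : b < p - 1)
    (hφ : ContDiff ℝ 2 φ)
    (hc : HasCompactSupport φ) (hf : ContDiff ℝ 1 f) (hL : ∀ x, ‖f x‖ ≤ L * ‖x‖)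
    (hA : ∀ x, ‖f x‖ ≤ A) :
    Integrable (fun x => ‖x‖ ^ (-b) * ‖f x‖ ^ (p - 1) * ⟪f x, transport φ f x⟫_ℝ) ∧
    Integrable (fun x => ‖x‖ ^ (-b) * ‖f x‖ ^ (p + 1) * virialWeight b p φ x) ∧
    -2 * ∫ x, ‖x‖ ^ (-b) * ‖f x‖ ^ (p - 1) * ⟪f x, transport φ f x⟫_ℝ =
      ∫ x, ‖x‖ ^ (-b) * ‖f x‖ ^ (p + 1) * virialWeight b p φ x := by
  have hp : 1 < p := by linarith
  have hfd := hf.differentiable (by norm_num)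
  have hk : ∀ k : Fin N, ContDiff ℝ 1 (pd (ee k) φ) := fun k => contDiff_pd _ hφ (by norm_num)
  have ck : ∀ k : Fin N, HasCompactSupport (pd (ee k) φ) := fun k => hasCompactSupport_pd _ hc
  have hfk : ∀ k : Fin N, Continuous (pd (ee k) f) := fun k => continuous_pd _ hf
  set V : EuclideanSpace ℝ (Fin N) → ℝ := fun x => ‖x‖ ^ (-b) * ‖f x‖ ^ (p - 1) with hV
  have Vm : AEStronglyMeasurable V volume :=
    (measurable_singular_potential hf.continuous b (p - 1)).aestronglyMeasurable
  have Vb : ∀ x, ‖V x‖ ≤ |L| ^ b * A ^ (p - 1 - b) := fun x => by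
    rw [Real.norm_of_nonneg (singular_potential_nonneg x)]
    exact singular_potential_le hb hbp hL hA x
  have hVI : ∀ g : EuclideanSpace ℝ (Fin N) → ℝ, Integrable g → Integrable fun x => V x * g x :=
    fun g hg => hg.bdd_mul Vm (Eventually.of_forall Vb)
  have I1 : Integrable (fun x => V x * ⟪f x, transport φ f x⟫_ℝ) :=
    hVI _ (integrable_inner_transport hφ hc hf.continuous hf)
  set g : Fin N → EuclideanSpace ℝ (Fin N) → ℝ := fun k x =>
    ‖x‖ ^ (-b) * ‖f x‖ ^ (p + 1) * pd (ee k) φ x with hg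
  have hgd : ∀ k, Differentiable ℝ (g k) := fun k =>
    differentiable_singular_mul hb hbp hfd hL hA ((hk k).differentiable (by norm_num))
  have hgi : ∀ k, Integrable (g k) := fun k =>
    (hgd k).continuous.integrable_of_hasCompactSupport (ck k).mul_left
  have hne : ∀ᵐ x : EuclideanSpace ℝ (Fin N), x ≠ 0 := by
    simp [ae_iff]
  have hgi' : ∀ k, Integrable (pd (ee k) (g k)) := fun k => by
    have e : (fun x => V x * ((p + 1) * ⟪f x, pd (ee k) f x⟫_ℝ * pd (ee k) φ x +
        ‖f x‖ ^ 2 * pd (ee k) (pd (ee k) φ) x -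
        b * ((‖f x‖ / ‖x‖) ^ 2 * (x k * pd (ee k) φ x)))) =ᵐ[volume] pd (ee k) (g k) := by
      filter_upwards [hne] with x hx
      exact (pd_singular_mul hp hfd ((hk k).differentiable (by norm_num)) hx k).symm
    refine Integrable.congr (hVI _ ?_) e
    have i1 : Integrable fun x => (p + 1) * ⟪f x, pd (ee k) f x⟫_ℝ * pd (ee k) φ x :=
      ((continuous_const.mul (hf.continuous.inner (hfk k))).mul
        (hk k).continuous).integrable_of_hasCompactSupport (ck k).mul_left
    have i2 : Integrable fun x => ‖f x‖ ^ 2 * pd (ee k) (pd (ee k) φ) x :=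
      ((hf.continuous.norm.pow 2).mul (continuous_pd _ (hk k))).integrable_of_hasCompactSupport
        (hasCompactSupport_pd _ (ck k)).mul_left
    have i3 : Integrable fun x : EuclideanSpace ℝ (Fin N) => x k * pd (ee k) φ x :=
      (Continuous.mul (by fun_prop) (hk k).continuous).integrable_of_hasCompactSupport
        (ck k).mul_left
    refine (i1.add i2).sub (Integrable.const_mul (i3.bdd_mul (c := L ^ 2) ?_ ?_) b)
    · exact ((hf.continuous.measurable.norm.div measurable_norm).pow_const 2).aestronglyMeasurable
    · filter_upwards [hne] with x hx
      have hx' : 0 < ‖x‖ := by simpa using hx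
      rw [Real.norm_of_nonneg (by positivity)]
      refine pow_le_pow_left₀ (by positivity) ?_ 2
      rw [div_le_iff₀ hx']
      exact hL x
  have hS : Integrable fun x => ∑ k, pd (ee k) (g k) x := integrable_finsetSum _ fun k _ => hgi' k
  have hS0 : ∫ x, ∑ k, pd (ee k) (g k) x = 0 := by
    rw [integral_finsetSum _ fun k _ => hgi' k]
    exact Finset.sum_eq_zero fun k _ => integral_pd_eq_zero (hgd k) (hgi k) (hgi' k)
  have key : (fun x => -2 * (V x * ⟪f x, transport φ f x⟫_ℝ) +
      4 / (p + 1) * ∑ k, pd (ee k) (g k) x) =ᵐ[volume]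
      fun x => ‖x‖ ^ (-b) * ‖f x‖ ^ (p + 1) * virialWeight b p φ x := by
    filter_upwards [hne] with x hx
    have hx' : 0 < ‖x‖ := by simpa using hx
    have hp' : p + 1 ≠ 0 := by linarith
    rw [rpow_add_one_eq hp (norm_nonneg _), virialWeight, lapR_eq, transport]
    simp only [Finset.sum_div, inner_sum, inner_add_right, real_inner_smul_right,
      Finset.mul_sum, ← Finset.sum_add_distrib]
    refine Finset.sum_congr rfl fun k _ => ?_
    rw [pd_singular_mul hp hfd ((hk k).differentiable (by norm_num)) hx k,
      real_inner_self_eq_norm_sq, hV]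
    field_simp
    ring
  have I2 := (I1.const_mul (-2)).add (hS.const_mul (4 / (p + 1)))
  refine ⟨I1, I2.congr key, ?_⟩
  rw [← integral_congr_ae key, integral_add (I1.const_mul (-2)) (hS.const_mul (4 / (p + 1))),
    integral_const_mul, integral_const_mul, hS0, mul_zero, add_zero]

end Nonlinear

section TimeDerivative

lemma hasDerivWithinAt_integral {E : Type*} [MeasurableSpace E] {μ : Measure E} {J : Set ℝ} {t : ℝ}
    (ht : t ∈ J) {F : ℝ → E → ℝ} {F' bound : E → ℝ} (hF : ∀ s ∈ J, Integrable (F s) μ)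
    (hb : Integrable bound μ)
    (hbd : ∀ᶠ s in 𝓝[J] t, ∀ᵐ x ∂μ, |F s x - F t x| ≤ bound x * |s - t|)
    (hd : ∀ᵐ x ∂μ, HasDerivWithinAt (fun s => F s x) (F' x) J t) :
    HasDerivWithinAt (fun s => ∫ x, F s x ∂μ) (∫ x, F' x ∂μ) J t := by
  rw [hasDerivWithinAt_iff_tendsto_slope]
  have hle : 𝓝[J \ {t}] t ≤ 𝓝[J] t := nhdsWithin_mono _ sdiff_subset
  have h1 : Tendsto (fun s => ∫ x, (s - t)⁻¹ * (F s x - F t x) ∂μ) (𝓝[J \ {t}] t)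
      (𝓝 (∫ x, F' x ∂μ)) := by
    refine tendsto_integral_filter_of_dominated_convergence bound ?_ ?_ hb ?_
    · filter_upwards [self_mem_nhdsWithin] with s hs
      exact (((hF s hs.1).sub (hF t ht)).const_mul _).aestronglyMeasurable
    · filter_upwards [hle hbd, self_mem_nhdsWithin] with s hs hs'
      have hst : 0 < |s - t| := abs_pos.2 (sub_ne_zero.2 hs'.2)
      filter_upwards [hs] with x hx
      rw [norm_mul, norm_inv, Real.norm_eq_abs, Real.norm_eq_abs, inv_mul_le_iff₀ hst]
      linarith
    · filter_upwards [hd] with x hx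
      rw [hasDerivWithinAt_iff_tendsto_slope] at hx
      simpa [slope_fun_def] using hx
  refine h1.congr' ?_
  filter_upwards [self_mem_nhdsWithin] with s hs
  rw [slope_def_module, integral_const_mul, integral_sub (hF s hs.1) (hF t ht), smul_eq_mul]

lemma Set.OrdConnected.exists_Icc_mem_nhdsWithin {J : Set ℝ} (hJ : J.OrdConnected) {t : ℝ}
    (ht : t ∈ J) : ∃ a c : ℝ, t ∈ Icc a c ∧ Icc a c ⊆ J ∧ Icc a c ∈ 𝓝[J] t := by
  have h1 : ∃ a ∈ J, a ≤ t ∧ ∀ᶠ s in 𝓝[J] t, a ≤ s := by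
    by_cases h : ∃ a ∈ J, a < t
    · obtain ⟨a, ha, hat⟩ := h
      exact ⟨a, ha, hat.le, nhdsWithin_le_nhds (Ici_mem_nhds hat)⟩
    · push Not at h
      exact ⟨t, ht, le_rfl, eventually_of_mem self_mem_nhdsWithin h⟩
  have h2 : ∃ c ∈ J, t ≤ c ∧ ∀ᶠ s in 𝓝[J] t, s ≤ c := by
    by_cases h : ∃ c ∈ J, t < c
    · obtain ⟨c, hc, htc⟩ := h
      exact ⟨c, hc, htc.le, nhdsWithin_le_nhds (Iic_mem_nhds htc)⟩
    · push Not at h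
      exact ⟨t, ht, le_rfl, eventually_of_mem self_mem_nhdsWithin h⟩
  obtain ⟨a, ha, hat, ha'⟩ := h1
  obtain ⟨c, hc, htc, hc'⟩ := h2
  refine ⟨a, c, ⟨hat, htc⟩, hJ.out ha hc, ?_⟩
  filter_upwards [ha', hc'] with s h h' using ⟨h, h'⟩

variable {N : ℕ} {b p : ℝ} {J : Set ℝ}

/-- The right-hand side of the equation solved for the time derivative. -/
def timeDeriv (b p : ℝ) (f : EuclideanSpace ℝ (Fin N) → ℂ) (x : EuclideanSpace ℝ (Fin N)) : ℂ :=
  Complex.I * (lap f x + ((‖x‖ ^ (-b) * ‖f x‖ ^ (p - 1) : ℝ) : ℂ) * f x)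

lemma norm_fderiv_le_seminorm (f : SchwartzMap (EuclideanSpace ℝ (Fin N)) ℂ)
    (x : EuclideanSpace ℝ (Fin N)) : ‖fderiv ℝ f x‖ ≤ SchwartzMap.seminorm ℝ 0 1 f := by
  have h := SchwartzMap.norm_iteratedFDeriv_le_seminorm ℝ f 1 x
  rwa [norm_iteratedFDeriv_one] at h

lemma norm_lap_le_seminorm (f : SchwartzMap (EuclideanSpace ℝ (Fin N)) ℂ)
    (x : EuclideanSpace ℝ (Fin N)) : ‖lap f x‖ ≤ N * SchwartzMap.seminorm ℝ 0 2 f := by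
  have h := SchwartzMap.norm_iteratedFDeriv_le_seminorm ℝ f 2 x
  have h1 : ∀ k : Fin N, ‖pd (ee k) (pd (ee k) f) x‖ ≤ SchwartzMap.seminorm ℝ 0 2 f := fun k => by
    have hd : DifferentiableAt ℝ (fderiv ℝ f) x :=
      ((f.smooth 2).fderiv_right (m := 1) (by norm_num)).differentiable (by norm_num) x
    have e : pd (ee k) (pd (ee k) f) x = iteratedFDeriv ℝ 2 f x ![ee k, ee k] := by
      rw [iteratedFDeriv_two_apply]
      change fderiv ℝ (fun y => fderiv ℝ f y (ee k)) x (ee k) = _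
      rw [fderiv_clm_apply hd (differentiableAt_const _)]
      simp
    rw [e]
    refine (ContinuousMultilinearMap.le_opNorm _ _).trans ?_
    simpa using h
  rw [lap_eq]
  refine (norm_sum_le _ _).trans ((Finset.sum_le_sum fun k _ => h1 k).trans ?_)
  simp

lemma norm_le_mul_norm_of_apply_zero {L : ℝ} (f : SchwartzMap (EuclideanSpace ℝ (Fin N)) ℂ)
    (hL : ∀ x, ‖fderiv ℝ f x‖ ≤ L) (h0 : f 0 = 0) (x : EuclideanSpace ℝ (Fin N)) :
    ‖f x‖ ≤ L * ‖x‖ := by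
  have := convex_univ.norm_image_sub_le_of_norm_fderiv_le (𝕜 := ℝ) (f := f)
    (fun y _ => f.differentiableAt) (fun y _ => hL y) (mem_univ 0) (mem_univ x)
  simpa [h0] using this

namespace INLSSolution

variable (sol : INLSSolution N b p J)

lemma hasDerivWithinAt {t : ℝ} (ht : t ∈ J) {x : EuclideanSpace ℝ (Fin N)} (hx : x ≠ 0) :
    HasDerivWithinAt (fun s => sol.u s x) (timeDeriv b p (sol.u t) x) J t := by
  obtain ⟨d, hd, he⟩ := sol.eqn t ht x hx
  have hd' : d = timeDeriv b p (sol.u t) x := by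
    rw [timeDeriv]
    linear_combination (-Complex.I) * he + d * Complex.I_sq
  exact hd' ▸ hd

lemma exists_uniform_bounds {K : Set ℝ} (hK : IsCompact K) (hKJ : K ⊆ J) :
    ∃ A L B : ℝ, 0 ≤ A ∧ 0 ≤ L ∧ 0 ≤ B ∧ ∀ s ∈ K, ∀ x,
      ‖sol.u s x‖ ≤ A ∧ ‖fderiv ℝ (sol.u s) x‖ ≤ L ∧ ‖lap (sol.u s) x‖ ≤ B := by
  obtain ⟨A, hA⟩ := sol.seminorm_bound K hKJ hK 0 0
  obtain ⟨L, hL⟩ := sol.seminorm_bound K hKJ hK 0 1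
  obtain ⟨B, hB⟩ := sol.seminorm_bound K hKJ hK 0 2
  refine ⟨max A 0, max L 0, N * max B 0, le_max_right _ _, le_max_right _ _, by positivity,
    fun s hs x => ⟨?_, ?_, ?_⟩⟩
  · exact (SchwartzMap.norm_le_seminorm ℝ _ _).trans ((hA s hs).trans (le_max_left _ _))
  · exact (norm_fderiv_le_seminorm _ x).trans ((hL s hs).trans (le_max_left _ _))
  · exact (norm_lap_le_seminorm _ x).trans
      (mul_le_mul_of_nonneg_left ((hB s hs).trans (le_max_left _ _)) (Nat.cast_nonneg _))

/-- The singular coefficient forces a classical solution to vanish at the origin. -/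
lemma apply_zero [NeZero N] (hb : 0 < b) (hp : 1 < p) (hJ : J.OrdConnected) (hJ' : J.Nontrivial)
    {t : ℝ} (ht : t ∈ J) : sol.u t 0 = 0 := by
  by_contra h0
  set F : ℝ × EuclideanSpace ℝ (Fin N) → ℂ := fun q =>
    ((‖sol.u q.1 q.2‖ ^ (p - 1) : ℝ) : ℂ) * sol.u q.1 q.2 with hF
  have hFc : ContinuousOn F (J ×ˢ univ) :=
    (Complex.continuous_ofReal.comp_continuousOn
      (sol.cont.norm.rpow_const fun _ _ => Or.inr (by linarith))).mul sol.cont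
  set θ := F (t, 0) with hθ
  have hθ0 : 0 < ‖θ‖ := by
    have : 0 < ‖sol.u t 0‖ := norm_pos_iff.2 h0
    rw [hθ, hF, norm_mul, Complex.norm_real, Real.norm_of_nonneg (by positivity)]
    positivity
  obtain ⟨ε, hε, hball⟩ := Metric.continuousOn_iff.1 hFc (t, 0) ⟨ht, mem_univ _⟩ (‖θ‖ / 2)
    (by positivity)
  obtain ⟨t', ht', hne⟩ := hJ'.exists_ne t
  have hconv : Convex ℝ J := hJ.convex
  have hd0 : 0 < |t' - t| := abs_pos.2 (sub_ne_zero.2 hne)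
  obtain ⟨η, hη0, hη1, hηε⟩ : ∃ η : ℝ, 0 < η ∧ η ≤ 1 ∧ η * |t' - t| < ε := by
    refine ⟨min 1 (ε / (2 * |t' - t|)), by positivity, min_le_left _ _, ?_⟩
    calc min 1 (ε / (2 * |t' - t|)) * |t' - t| ≤ ε / (2 * |t' - t|) * |t' - t| := by
          gcongr; exact min_le_right _ _
      _ = ε / 2 := by field_simp
      _ < ε := by linarith
  set τ := t + η * (t' - t) with hτ
  have hτJ : τ ∈ J := by
    have := hconv ht ht' (sub_nonneg.2 hη1) hη0.le (by ring)
    convert this using 1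
    simp [hτ]; ring
  have hτt : |τ - t| = η * |t' - t| := by
    rw [hτ, add_sub_cancel_left, abs_mul, abs_of_pos hη0]
  have hτ0 : 0 < |τ - t| := by rw [hτt]; positivity
  have hsub : uIcc t τ ⊆ J := hJ.uIcc_subset ht hτJ
  obtain ⟨A, L, B, hA, hL, hB, hbd⟩ := sol.exists_uniform_bounds isCompact_uIcc hsub
  have main : ∀ r : ℝ, 0 < r → r < ε → |τ - t| * (r ^ (-b) * (‖θ‖ / 2)) ≤ 2 * A + B * |τ - t| := by
    intro r hr hrε
    set x : EuclideanSpace ℝ (Fin N) := EuclideanSpace.single 0 r with hx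
    have hxn : ‖x‖ = r := by simp [hx, abs_of_pos hr]
    have hx0 : x ≠ 0 := by rw [← norm_pos_iff, hxn]; exact hr
    have hder : ∀ s ∈ uIcc t τ, HasDerivWithinAt
        (fun s : ℝ => sol.u s x - s • (Complex.I * ((r ^ (-b) : ℝ) * θ)))
        (timeDeriv b p (sol.u s) x - (1 : ℝ) • (Complex.I * ((r ^ (-b) : ℝ) * θ)))
        (uIcc t τ) s := fun s hs =>
      ((sol.hasDerivWithinAt (hsub hs) hx0).mono hsub).sub
        ((hasDerivWithinAt_id s _).smul_const _)
    have hnorm : ∀ s ∈ uIcc t τ,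
        ‖timeDeriv b p (sol.u s) x - (1 : ℝ) • (Complex.I * ((r ^ (-b) : ℝ) * θ))‖ ≤
          B + r ^ (-b) * (‖θ‖ / 2) := fun s hs => by
      have e : timeDeriv b p (sol.u s) x - (1 : ℝ) • (Complex.I * ((r ^ (-b) : ℝ) * θ)) =
          Complex.I * (lap (sol.u s) x + (r ^ (-b) : ℝ) * (F (s, x) - θ)) := by
        simp only [timeDeriv, hF, hxn, one_smul]
        push_cast
        ring
      rw [e, norm_mul, Complex.norm_I, one_mul]
      refine (norm_add_le _ _).trans (add_le_add (hbd s hs x).2.2 ?_)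
      rw [norm_mul, Complex.norm_real, Real.norm_of_nonneg (by positivity)]
      refine mul_le_mul_of_nonneg_left ?_ (by positivity)
      rw [← dist_eq_norm]
      refine (hball (s, x) ⟨hsub hs, mem_univ _⟩ ?_).le
      rw [Prod.dist_eq, max_lt_iff]
      refine ⟨?_, by simpa [hxn] using hrε⟩
      rw [Real.dist_eq]
      exact (abs_sub_left_of_mem_uIcc hs).trans_lt (by rw [hτt]; exact hηε)
    have := (convex_uIcc t τ).norm_image_sub_le_of_norm_hasDerivWithin_le hder hnorm
      left_mem_uIcc right_mem_uIcc
    have e : sol.u τ x - τ • (Complex.I * ((r ^ (-b) : ℝ) * θ)) -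
        (sol.u t x - t • (Complex.I * ((r ^ (-b) : ℝ) * θ))) =
        (sol.u τ x - sol.u t x) - (τ - t) • (Complex.I * ((r ^ (-b) : ℝ) * θ)) := by
      rw [sub_smul]; ring
    rw [e] at this
    have h2 := norm_sub_norm_le ((τ - t) • (Complex.I * ((r ^ (-b) : ℝ) * θ)))
      (sol.u τ x - sol.u t x)
    rw [norm_smul, norm_mul, norm_mul, Complex.norm_I, one_mul, Complex.norm_real,
      Real.norm_of_nonneg (show 0 ≤ r ^ (-b) by positivity), Real.norm_eq_abs] at h2
    have h3 := norm_sub_le (sol.u τ x) (sol.u t x)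
    have h4 := (hbd τ right_mem_uIcc x).1
    have h5 := (hbd t left_mem_uIcc x).1
    rw [Real.norm_eq_abs, norm_sub_rev] at this
    linarith
  have hlim : Tendsto (fun r : ℝ => |τ - t| * (r ^ (-b) * (‖θ‖ / 2))) (𝓝[>] 0) atTop :=
    ((tendsto_rpow_neg_nhdsGT_zero (neg_lt_zero.2 hb)).atTop_mul_const
      (by positivity)).const_mul_atTop hτ0
  obtain ⟨r, h1, h2⟩ := ((hlim.eventually_gt_atTop (2 * A + B * |τ - t|)).and
    (Ioo_mem_nhdsGT hε)).exists
  exact absurd (main r h2.1 h2.2) (not_le.2 h1)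

end INLSSolution

end TimeDerivative

section VirialIdentities

variable {N : ℕ} {b p : ℝ} {J : Set ℝ} {φ : EuclideanSpace ℝ (Fin N) → ℝ}

lemma Set.OrdConnected.uniqueDiffOn_of_nontrivial (hJ : J.OrdConnected) (hJ' : J.Nontrivial) :
    UniqueDiffOn ℝ J := by
  obtain ⟨a, ha, c, hc, hac⟩ := hJ'.exists_lt
  refine uniqueDiffOn_convex hJ.convex ?_
  have h : Ioo a c ⊆ interior J :=
    interior_maximal (Ioo_subset_Icc_self.trans (hJ.out ha hc)) isOpen_Ioo
  exact (nonempty_Ioo.2 hac).mono h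

lemma inner_self_I_mul (r : ℝ) (z : ℂ) : ⟪z, Complex.I * (r * z)⟫_ℝ = 0 := by
  simp [Complex.inner]
  ring

lemma norm_transport_le {f : EuclideanSpace ℝ (Fin N) → ℂ} {A L : ℝ}
    {x : EuclideanSpace ℝ (Fin N)} (hA : ‖f x‖ ≤ A) (hL : ‖fderiv ℝ f x‖ ≤ L) :
    ‖transport φ f x‖ ≤
      ∑ k : Fin N, (2 * |pd (ee k) φ x| * L + |pd (ee k) (pd (ee k) φ) x| * A) := by
  refine (norm_sum_le _ _).trans (Finset.sum_le_sum fun k _ => (norm_add_le _ _).trans ?_)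
  have h : ‖pd (ee k) f x‖ ≤ L :=
    ((fderiv ℝ f x).le_opNorm _).trans (by simpa using hL)
  rw [norm_smul, norm_smul, norm_mul, Real.norm_eq_abs, Real.norm_eq_abs, Real.norm_eq_abs, abs_two]
  gcongr

namespace INLSSolution

variable (sol : INLSSolution N b p J)

/-- Spatial derivatives are continuous in time away from the origin. -/
lemma tendsto_pd (hJ : J.OrdConnected) (hJ' : J.Nontrivial) {t : ℝ} (ht : t ∈ J)
    {x : EuclideanSpace ℝ (Fin N)} (hx : x ≠ 0) (v : EuclideanSpace ℝ (Fin N)) :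
    Tendsto (fun s => pd v (sol.u s) x) (𝓝[J] t) (𝓝 (pd v (sol.u t) x)) := by
  set F : ℝ × EuclideanSpace ℝ (Fin N) → ℂ := fun q => sol.u q.1 q.2
  set U : Set (ℝ × EuclideanSpace ℝ (Fin N)) := J ×ˢ {x | x ≠ 0}
  have hU : UniqueDiffOn ℝ U :=
    (hJ.uniqueDiffOn_of_nontrivial hJ').prod isOpen_ne.uniqueDiffOn
  have hc : ContinuousOn (fderivWithin ℝ F U) U :=
    sol.smooth.continuousOn_fderivWithin hU (by simp)
  have he : ∀ s ∈ J, fderivWithin ℝ F U (s, x) (0, v) = pd v (sol.u s) x := fun s hs => by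
    have h1 : HasFDerivWithinAt F (fderivWithin ℝ F U (s, x)) U (s, x) :=
      (sol.smooth.differentiableOn (by simp) (s, x) ⟨hs, hx⟩).hasFDerivWithinAt
    have hm : MapsTo (fun y : EuclideanSpace ℝ (Fin N) => (s, y)) {y | y ≠ 0} U :=
      fun y hy => ⟨hs, hy⟩
    have h2 := h1.comp x (hasFDerivAt_prodMk_right s x).hasFDerivWithinAt hm
    have h3 : HasFDerivAt (sol.u s) _ x := h2.hasFDerivAt (isOpen_ne.mem_nhds hx)
    rw [pd, h3.fderiv]
    rfl
  have h1 : Tendsto (fun s : ℝ => (s, x)) (𝓝[J] t) (𝓝[U] (t, x)) :=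
    tendsto_nhdsWithin_iff.2 ⟨((Continuous.prodMk_left x).tendsto t).mono_left nhdsWithin_le_nhds,
      eventually_of_mem self_mem_nhdsWithin fun s hs => ⟨hs, hx⟩⟩
  have h2 := (((ContinuousLinearMap.apply ℝ ℂ ((0 : ℝ), v)).continuous.tendsto _).comp
    (hc (t, x) ⟨ht, hx⟩).tendsto).comp h1
  rw [ContinuousLinearMap.apply_apply, he t ht] at h2
  refine h2.congr' (eventually_of_mem self_mem_nhdsWithin fun s hs => ?_)
  exact he s hs

lemma tendsto_transport (hJ : J.OrdConnected) (hJ' : J.Nontrivial) {t : ℝ} (ht : t ∈ J)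
    {x : EuclideanSpace ℝ (Fin N)} (hx : x ≠ 0) :
    Tendsto (fun s => transport φ (sol.u s) x) (𝓝[J] t) (𝓝 (transport φ (sol.u t) x)) :=
  tendsto_finsetSum _ fun k _ => ((sol.tendsto_pd hJ hJ' ht hx (ee k)).const_smul _).add
    ((sol.hasDerivWithinAt ht hx).continuousWithinAt.tendsto.const_smul _)

lemma exists_local_bounds [NeZero N] (hb : 0 < b) (hbp : b < p - 1) (hJ : J.OrdConnected)
    (hJ' : J.Nontrivial) {t : ℝ} (ht : t ∈ J) :
    ∃ A L T : ℝ, 0 ≤ A ∧ 0 ≤ L ∧ 0 ≤ T ∧ ∃ K ∈ 𝓝[J] t, t ∈ K ∧ K ⊆ J ∧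
      (∀ s ∈ K, ∀ x, ‖sol.u s x‖ ≤ A) ∧ (∀ s ∈ K, ∀ x, ‖fderiv ℝ (sol.u s) x‖ ≤ L) ∧
      ∀ s ∈ K, ∀ x, x ≠ 0 → ‖sol.u s x - sol.u t x‖ ≤ T * |s - t| := by
  obtain ⟨a, c, hac, hsub, hnhds⟩ := hJ.exists_Icc_mem_nhdsWithin ht
  obtain ⟨A, L, B, hA, hL, hB, hbd⟩ := sol.exists_uniform_bounds isCompact_Icc hsub
  refine ⟨A, L, B + |L| ^ b * A ^ (p - 1 - b) * A, hA, hL, by positivity, Icc a c, hnhds, hac,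
    hsub, fun s hs x => (hbd s hs x).1, fun s hs x => (hbd s hs x).2.1, fun s hs x hx => ?_⟩
  have hT : ∀ r ∈ Icc a c,
      ‖timeDeriv b p (sol.u r) x‖ ≤ B + |L| ^ b * A ^ (p - 1 - b) * A := fun r hr => by
    have hV := singular_potential_le (f := sol.u r) hb hbp
      (norm_le_mul_norm_of_apply_zero _ (fun y => (hbd r hr y).2.1)
        (sol.apply_zero hb (by linarith) hJ hJ' (hsub hr))) (fun y => (hbd r hr y).1) x
    rw [timeDeriv, norm_mul, Complex.norm_I, one_mul]
    refine (norm_add_le _ _).trans (add_le_add (hbd r hr x).2.2 ?_)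
    rw [norm_mul, Complex.norm_real, Real.norm_of_nonneg (singular_potential_nonneg x)]
    exact mul_le_mul hV (hbd r hr x).1 (norm_nonneg _) (by positivity)
  have := (convex_Icc a c).norm_image_sub_le_of_norm_hasDerivWithin_le
    (fun r hr => (sol.hasDerivWithinAt (hsub hr) hx).mono hsub) hT hac hs
  rwa [Real.norm_eq_abs] at this

/-- The localized virial quantity is differentiable in time. -/
lemma hasDerivWithinAt_integral_weight [NeZero N] (hb : 0 < b) (hbp : b < p - 1)
    (hJ : J.OrdConnected) (hJ' : J.Nontrivial) (hφ : ContDiff ℝ 2 φ) (hc : HasCompactSupport φ)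
    {t : ℝ} (ht : t ∈ J) :
    HasDerivWithinAt (fun s => ∫ x, φ x * ‖sol.u s x‖ ^ 2)
      (∫ x, ⟪Complex.I * sol.u t x, transport φ (sol.u t) x⟫_ℝ) J t := by
  obtain ⟨A, L, T, hA, hL, hT, K, hK, htK, hKJ, hbA, hbL, hbT⟩ :=
    sol.exists_local_bounds hb hbp hJ hJ' ht
  have hne : ∀ᵐ x : EuclideanSpace ℝ (Fin N), x ≠ 0 := by simp [ae_iff]
  rw [← integral_weight_inner_lap hφ hc ((sol.u t).smooth 2)]
  refine hasDerivWithinAt_integral ht (bound := fun x => ‖φ x‖ * (2 * A * T)) (fun s _ => ?_) ?_ ?_ ?_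
  · exact (hφ.continuous.mul ((sol.u s).continuous.norm.pow 2)).integrable_of_hasCompactSupport
      hc.mul_right
  · exact ((hφ.continuous.integrable_of_hasCompactSupport hc).norm).mul_const _
  · filter_upwards [hK] with s hs
    filter_upwards [hne] with x hx
    have h1 := abs_norm_sub_norm_le (sol.u s x) (sol.u t x)
    have h2 := hbT s hs x hx
    have h3 : |‖sol.u s x‖ + ‖sol.u t x‖| ≤ 2 * A := by
      rw [abs_of_nonneg (by positivity)]
      linarith [hbA s hs x, hbA t htK x]
    rw [← mul_sub, abs_mul, sq_sub_sq, abs_mul, Real.norm_eq_abs, mul_assoc]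
    refine mul_le_mul_of_nonneg_left ?_ (abs_nonneg _)
    rw [mul_assoc (2 * A)]
    exact mul_le_mul h3 (h1.trans h2) (abs_nonneg _) (by positivity)
  · filter_upwards [hne] with x hx
    have h := ((sol.hasDerivWithinAt ht hx).norm_sq).const_mul (φ x)
    refine h.congr_deriv ?_
    rw [timeDeriv, mul_add, inner_add_right, inner_self_I_mul, add_zero]

lemma hasDerivWithinAt_integral_momentum [NeZero N] (hb : 0 < b) (hbp : b < p - 1)
    (hJ : J.OrdConnected) (hJ' : J.Nontrivial) (hφ : ContDiff ℝ 2 φ) (hc : HasCompactSupport φ)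
    {t : ℝ} (ht : t ∈ J) :
    HasDerivWithinAt (fun s => ∫ x, ⟪Complex.I * sol.u s x, transport φ (sol.u s) x⟫_ℝ)
      (∫ x, 2 * ⟪Complex.I * timeDeriv b p (sol.u t) x, transport φ (sol.u t) x⟫_ℝ) J t := by
  obtain ⟨A, L, T, hA, hL, hT, K, hK, htK, hKJ, hbA, hbL, hbT⟩ :=
    sol.exists_local_bounds hb hbp hJ hJ' ht
  have hne : ∀ᵐ x : EuclideanSpace ℝ (Fin N), x ≠ 0 := by simp [ae_iff]
  have hu : ∀ s, ContDiff ℝ 1 (sol.u s) := fun s => (sol.u s).smooth 1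
  have hI : ∀ r s, Integrable fun x => ⟪Complex.I * sol.u r x, transport φ (sol.u s) x⟫_ℝ :=
    fun r s => integrable_inner_transport hφ hc (continuous_const.mul (sol.u r).continuous) (hu s)
  set F : ℝ → EuclideanSpace ℝ (Fin N) → ℝ := fun s x =>
    ⟪Complex.I * (sol.u s x - sol.u t x),
      transport φ (sol.u s) x + transport φ (sol.u t) x⟫_ℝ with hF
  have hFe : ∀ s, F s = fun x => (⟪Complex.I * sol.u s x, transport φ (sol.u s) x⟫_ℝ +
      ⟪Complex.I * sol.u s x, transport φ (sol.u t) x⟫_ℝ) -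
      (⟪Complex.I * sol.u t x, transport φ (sol.u s) x⟫_ℝ +
      ⟪Complex.I * sol.u t x, transport φ (sol.u t) x⟫_ℝ) := fun s => by
    ext x
    simp only [hF, mul_sub, inner_sub_left, inner_add_right]
    ring
  have hI2 : ∀ r s, Integrable fun x => ⟪Complex.I * sol.u r x, transport φ (sol.u s) x⟫_ℝ +
      ⟪Complex.I * sol.u r x, transport φ (sol.u t) x⟫_ℝ := fun r s => (hI r s).add (hI r t)
  have hFI : ∀ s, Integrable (F s) := fun s => by
    rw [hFe]
    exact (hI2 s s).sub (hI2 t s)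
  have hFs : ∀ s, ∫ x, ⟪Complex.I * sol.u s x, transport φ (sol.u s) x⟫_ℝ =
      (∫ x, F s x) + ∫ x, ⟪Complex.I * sol.u t x, transport φ (sol.u t) x⟫_ℝ := fun s => by
    simp only [hFe]
    rw [integral_sub (hI2 s s) (hI2 t s), integral_add (hI _ _) (hI _ _),
      integral_add (hI _ _) (hI _ _), integral_inner_transport_comm hφ hc (hu s) (hu t)]
    ring
  rw [funext hFs]
  refine HasDerivWithinAt.add_const _ ?_
  set W : EuclideanSpace ℝ (Fin N) → ℝ := fun x =>
    ∑ k : Fin N, (2 * |pd (ee k) φ x| * L + |pd (ee k) (pd (ee k) φ) x| * A) with hW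
  have hWI : Integrable W := by
    refine integrable_finsetSum _ fun k _ => ?_
    have hk : ContDiff ℝ 1 (pd (ee k) φ) := contDiff_pd _ hφ (by norm_num)
    have ck := hasCompactSupport_pd (ee k) hc
    exact (((hk.continuous.integrable_of_hasCompactSupport ck).abs.const_mul 2).mul_const L).add
      (((continuous_pd _ hk).integrable_of_hasCompactSupport
        (hasCompactSupport_pd _ ck)).abs.mul_const A)
  refine hasDerivWithinAt_integral ht (bound := fun x => T * (2 * W x)) (fun s _ => hFI s)
    ((hWI.const_mul 2).const_mul T) ?_ ?_
  · filter_upwards [hK] with s hs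
    filter_upwards [hne] with x hx
    have h0 : F t x = 0 := by simp [hF]
    rw [h0, sub_zero, ← Real.norm_eq_abs]
    refine (norm_inner_le_norm _ _).trans ?_
    rw [norm_mul, Complex.norm_I, one_mul]
    have h1 : ‖transport φ (sol.u s) x + transport φ (sol.u t) x‖ ≤ 2 * W x := by
      refine (norm_add_le _ _).trans ?_
      have h1 := norm_transport_le (φ := φ) (hbA s hs x) (hbL s hs x)
      have h2 := norm_transport_le (φ := φ) (hbA t htK x) (hbL t htK x)
      linarith
    calc _ ≤ T * |s - t| * (2 * W x) :=
          mul_le_mul (hbT s hs x hx) h1 (norm_nonneg _) (by positivity)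
      _ = _ := by ring
  · filter_upwards [hne] with x hx
    rw [hasDerivWithinAt_iff_tendsto_slope]
    have hle : 𝓝[J \ {t}] t ≤ 𝓝[J] t := nhdsWithin_mono _ sdiff_subset
    have h1 := hasDerivWithinAt_iff_tendsto_slope.1 (sol.hasDerivWithinAt ht hx)
    have h2 := (sol.tendsto_transport (φ := φ) hJ hJ' ht hx).mono_left hle
    have h3 := (h1.const_mul Complex.I).inner (𝕜 := ℝ)
      (h2.add (tendsto_const_nhds (x := transport φ (sol.u t) x)))
    have e : ⟪Complex.I * timeDeriv b p (sol.u t) x,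
        transport φ (sol.u t) x + transport φ (sol.u t) x⟫_ℝ =
        2 * ⟪Complex.I * timeDeriv b p (sol.u t) x, transport φ (sol.u t) x⟫_ℝ := by
      rw [inner_add_right]; ring
    rw [e] at h3
    refine h3.congr fun s => ?_
    have h0 : F t x = 0 := by simp [hF]
    rw [slope_def_module, slope_def_module, h0, sub_zero, hF, mul_smul_comm, real_inner_smul_left,
      smul_eq_mul]

/-- The second virial identity. -/
lemma integral_two_mul_inner_timeDeriv [NeZero N] (hb : 0 < b) (hbp : b < p - 1)
    (hJ : J.OrdConnected) (hJ' : J.Nontrivial) (hφ : ContDiff ℝ 4 φ) (hc : HasCompactSupport φ)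
    {t : ℝ} (ht : t ∈ J) :
    Integrable (fun x => ‖x‖ ^ (-b) * ‖sol.u t x‖ ^ (p + 1) * virialWeight b p φ x) ∧
    ∫ x, 2 * ⟪Complex.I * timeDeriv b p (sol.u t) x, transport φ (sol.u t) x⟫_ℝ =
      (∫ x, (4 * ∑ j, ∑ k, pd (ee j) (pd (ee k) φ) x *
          ⟪pd (ee j) (sol.u t) x, pd (ee k) (sol.u t) x⟫_ℝ
        - lapR (lapR φ) x * ‖sol.u t x‖ ^ 2)) +
      ∫ x, ‖x‖ ^ (-b) * ‖sol.u t x‖ ^ (p + 1) * virialWeight b p φ x := by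
  obtain ⟨A, L, T, -, -, -, K, -, htK, -, hbA, hbL, -⟩ := sol.exists_local_bounds hb hbp hJ hJ' ht
  have hu1 : ContDiff ℝ 1 (sol.u t) := (sol.u t).smooth 1
  have hu2 : ContDiff ℝ 2 (sol.u t) := (sol.u t).smooth 2
  have hφ2 : ContDiff ℝ 2 φ := hφ.of_le (by norm_num)
  obtain ⟨I1, I2, h⟩ := integral_singular_inner_transport (f := sol.u t) hb hbp hφ2 hc hu1
    (norm_le_mul_norm_of_apply_zero _ (hbL t htK)
      (sol.apply_zero hb (by linarith) hJ hJ' ht)) (hbA t htK)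
  refine ⟨I2, ?_⟩
  have hlap : Continuous (lap (sol.u t)) := by
    have : ∀ k : Fin N, Continuous (pd (ee k) (pd (ee k) (sol.u t))) := fun k =>
      continuous_pd _ (contDiff_pd _ hu2 (by norm_num))
    change Continuous fun x => ∑ k, pd (ee k) (pd (ee k) (sol.u t)) x
    fun_prop
  have I0 := integrable_inner_transport hφ2 hc hlap hu1
  rw [← h, ← integral_inner_lap_transport hφ hc ((sol.u t).smooth 3), ← mul_add,
    ← integral_add I0 I1, ← integral_const_mul]
  congr 1; ext x
  have e : Complex.I * timeDeriv b p (sol.u t) x =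
      -(lap (sol.u t) x + (‖x‖ ^ (-b) * ‖sol.u t x‖ ^ (p - 1)) • sol.u t x) := by
    rw [timeDeriv, ← mul_assoc, Complex.I_mul_I, Complex.real_smul, neg_one_mul]
  rw [e, inner_neg_left, inner_add_left, real_inner_smul_left]
  ring

end INLSSolution

end VirialIdentities

section VirialEstimate

lemma integral_mono_of_nonneg_right {E : Type*} [MeasurableSpace E] {μ : Measure E} {f g : E → ℝ}
    (hg : Integrable g μ) (hfg : f ≤ᵐ[μ] g) (h0 : 0 ≤ᵐ[μ] g) : ∫ x, f x ∂μ ≤ ∫ x, g x ∂μ := by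
  by_cases hf : Integrable f μ
  · exact integral_mono_ae hf hg hfg
  · rw [integral_undef hf]
    exact integral_nonneg_of_ae h0

variable {N : ℕ} {b p : ℝ} {w : ℝ → ℝ} {R C₃ : ℝ}

lemma hasCompactSupport_comp_norm {r₀ : ℝ} (h : ∀ r, r₀ ≤ r → w r = 0) :
    HasCompactSupport fun x : EuclideanSpace ℝ (Fin N) => w ‖x‖ :=
  HasCompactSupport.intro (isCompact_closedBall 0 r₀) fun x hx => h _ (by
    simp only [Metric.mem_closedBall, dist_zero_right, not_le] at hx
    exact hx.le)

lemma virialWeight_comp_norm (hw : ContDiff ℝ 2 w) {x : EuclideanSpace ℝ (Fin N)} (hx : x ≠ 0) :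
    virialWeight b p (fun y => w ‖y‖) x = -(4 * b / (p + 1)) * (deriv w ‖x‖ / ‖x‖) +
      (4 / (p + 1) - 2) * (deriv (deriv w) ‖x‖ + ((N : ℝ) - 1) * (deriv w ‖x‖ / ‖x‖)) := by
  have hx' : ‖x‖ ≠ 0 := by simpa using hx
  rw [virialWeight, lapR_comp_norm hw hx,
    sum_coord_mul_pd_comp_norm (hw.differentiable (by norm_num)) hx]
  field_simp

lemma virialWeight_eq_of_norm_lt (hp : 1 < p) (hw : ContDiff ℝ 2 w)
    (hwr : ∀ r ∈ Icc (0 : ℝ) R, w r = r ^ 2) {x : EuclideanSpace ℝ (Fin N)} (hx : x ≠ 0)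
    (hxR : ‖x‖ < R) :
    virialWeight b p (fun y => w ‖y‖) x = -8 * ((N * (p - 1) + 2 * b) / (2 * (p + 1))) := by
  have hx' : 0 < ‖x‖ := by simpa using hx
  have hp' : p + 1 ≠ 0 := by linarith
  obtain ⟨h1, h2⟩ := deriv_eq_of_eq_sq hwr ⟨hx', hxR⟩
  rw [virialWeight_comp_norm hw hx, h1, h2]
  field_simp
  ring

lemma abs_virialWeight_le (hN : 1 ≤ N) (hb : 0 < b) (hp : 1 < p) (hw : ContDiff ℝ 2 w)
    (h0 : deriv w 0 = 0) (h2 : ∀ r, 0 ≤ r → |deriv (deriv w) r| ≤ C₃)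
    {x : EuclideanSpace ℝ (Fin N)} (hx : x ≠ 0) :
    |virialWeight b p (fun y => w ‖y‖) x| ≤
      4 * b / (p + 1) * C₃ + 2 * (p - 1) / (p + 1) * (N * C₃) := by
  have hx' : 0 < ‖x‖ := by simpa using hx
  have hN' : (1 : ℝ) ≤ N := by exact_mod_cast hN
  have hq : |deriv w ‖x‖ / ‖x‖| ≤ C₃ := by
    rw [abs_div, abs_norm, div_le_iff₀ hx']
    exact abs_deriv_le hw h0 h2 hx'.le
  have hl : |deriv (deriv w) ‖x‖ + ((N : ℝ) - 1) * (deriv w ‖x‖ / ‖x‖)| ≤ N * C₃ := by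
    refine (abs_add_le _ _).trans ?_
    rw [abs_mul, abs_of_nonneg (sub_nonneg.2 hN')]
    have := h2 ‖x‖ hx'.le
    nlinarith
  rw [virialWeight_comp_norm hw hx]
  refine (abs_add_le _ _).trans (add_le_add ?_ ?_)
  · rw [abs_mul, abs_neg, abs_of_nonneg (by positivity)]
    gcongr
  · have e : 4 / (p + 1) - 2 = -(2 * (p - 1) / (p + 1)) := by field_simp; ring
    have h : 0 ≤ 2 * (p - 1) / (p + 1) := div_nonneg (by linarith) (by linarith)
    rw [e, abs_mul, abs_neg, abs_of_nonneg h]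
    gcongr

lemma integrable_gradNormSq (f : SchwartzMap (EuclideanSpace ℝ (Fin N)) ℂ) :
    Integrable (gradNormSq f) := by
  refine integrable_finsetSum _ fun k _ => ?_
  have h := (LineDeriv.lineDerivOp (ee k) f).memLp 2 (volume : Measure (EuclideanSpace ℝ (Fin N)))
  exact (memLp_two_iff_integrable_sq_norm h.1).1 h

lemma gradNormSq_nonneg (f : EuclideanSpace ℝ (Fin N) → ℂ) (x : EuclideanSpace ℝ (Fin N)) :
    0 ≤ gradNormSq f x :=
  Finset.sum_nonneg fun _ _ => by positivity

lemma integrable_norm_rpow (f : SchwartzMap (EuclideanSpace ℝ (Fin N)) ℂ) {q : ℝ} (hq : 0 < q) :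
    Integrable fun x => ‖f x‖ ^ q := by
  have h := (f.memLp (ENNReal.ofReal q)
    (volume : Measure (EuclideanSpace ℝ (Fin N)))).integrable_norm_rpow
    (ENNReal.ofReal_pos.2 hq).ne' ENNReal.ofReal_ne_top
  rwa [ENNReal.toReal_ofReal hq.le] at h

lemma integrable_singular_density (hb : 0 < b) (hbp : b < p - 1)
    (f : SchwartzMap (EuclideanSpace ℝ (Fin N)) ℂ) {L A : ℝ} (hL : ∀ x, ‖f x‖ ≤ L * ‖x‖)
    (hA : ∀ x, ‖f x‖ ≤ A) : Integrable fun x => ‖x‖ ^ (-b) * ‖f x‖ ^ (p + 1) := by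
  have h2 : Integrable fun x => ‖f x‖ ^ 2 :=
    (memLp_two_iff_integrable_sq_norm f.continuous.aestronglyMeasurable).1 (f.memLp 2)
  have h := h2.bdd_mul (c := |L| ^ b * A ^ (p - 1 - b))
    (measurable_singular_potential f.continuous b (p - 1)).aestronglyMeasurable
    (Eventually.of_forall fun x => by
      rw [Real.norm_of_nonneg (singular_potential_nonneg x)]
      exact singular_potential_le hb hbp hL hA x)
  refine h.congr (Eventually.of_forall fun x => ?_)
  simp only [rpow_add_one_eq (show 1 < p by linarith) (norm_nonneg (f x)), mul_assoc]

/-- Bound for the second virial identity in terms of the functional `K`. -/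
lemma virial_le (hN : 1 ≤ N) (hb : 0 < b) (hbp : b < p - 1) (hR : 0 < R) (hC₃ : 0 < C₃)
    (hw : ContDiff ℝ 2 w) (hwr : ∀ r ∈ Icc (0 : ℝ) R, w r = r ^ 2)
    (hw2 : ∀ r : ℝ, 0 ≤ r → deriv (deriv w) r ≤ 2 ∧ |deriv (deriv w) r| ≤ C₃)
    (hΔ : ∀ x : EuclideanSpace ℝ (Fin N),
      |lapR (lapR (fun y : EuclideanSpace ℝ (Fin N) => w ‖y‖)) x| ≤ C₃ / R ^ 2)
    (f : SchwartzMap (EuclideanSpace ℝ (Fin N)) ℂ) {L A : ℝ} (hL : ∀ x, ‖f x‖ ≤ L * ‖x‖)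
    (hA : ∀ x, ‖f x‖ ≤ A)
    (hI : Integrable fun x => ‖x‖ ^ (-b) * ‖f x‖ ^ (p + 1) * virialWeight b p (fun y => w ‖y‖) x) :
    (∫ x, (4 * ∑ j, ∑ k, pd (ee j) (pd (ee k) (fun y => w ‖y‖)) x *
          ⟪pd (ee j) f x, pd (ee k) f x⟫_ℝ - lapR (lapR (fun y => w ‖y‖)) x * ‖f x‖ ^ 2)) +
      ∫ x, ‖x‖ ^ (-b) * ‖f x‖ ^ (p + 1) * virialWeight b p (fun y => w ‖y‖) x ≤
    8 * Kq N b p f + C₃ / R ^ 2 * (∫ x, ‖f x‖ ^ 2) +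
      (4 * b / (p + 1) * C₃ + 2 * (p - 1) / (p + 1) * (N * C₃) +
        8 * ((N * (p - 1) + 2 * b) / (2 * (p + 1)))) * (R ^ (-b) * ∫ x, ‖f x‖ ^ (p + 1)) := by
  have : NeZero N := ⟨by omega⟩
  have hp : 1 < p := by linarith
  have hne : ∀ᵐ x : EuclideanSpace ℝ (Fin N), x ≠ 0 := by simp [ae_iff]
  have h0 := deriv_zero_of_eq_sq hR hw hwr
  set κ := (N * (p - 1) + 2 * b) / (2 * (p + 1)) with hκ
  set Cm := 4 * b / (p + 1) * C₃ + 2 * (p - 1) / (p + 1) * (N * C₃) with hCm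
  have hp1 : 0 ≤ p - 1 := by linarith
  have hκ0 : 0 ≤ κ := by positivity
  have hCm0 : 0 ≤ Cm := by positivity
  have i1 := (integrable_gradNormSq f).const_mul 8
  have i2 : Integrable fun x => ‖f x‖ ^ 2 :=
    (memLp_two_iff_integrable_sq_norm f.continuous.aestronglyMeasurable).1 (f.memLp 2)
  have i3 := integrable_norm_rpow f (show 0 < p + 1 by linarith)
  have i4 := integrable_singular_density hb hbp f hL hA
  have hlin : (∫ x, (4 * ∑ j, ∑ k, pd (ee j) (pd (ee k) (fun y => w ‖y‖)) x *
      ⟪pd (ee j) f x, pd (ee k) f x⟫_ℝ - lapR (lapR (fun y => w ‖y‖)) x * ‖f x‖ ^ 2)) ≤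
      8 * (∫ x, gradNormSq f x) + C₃ / R ^ 2 * (∫ x, ‖f x‖ ^ 2) := by
    rw [← integral_const_mul, ← integral_const_mul, ← integral_add i1 (i2.const_mul _)]
    refine integral_mono_of_nonneg_right (i1.add (i2.const_mul _)) ?_ ?_
    · filter_upwards [hne] with x hx
      have h1 := hessian_comp_norm_le hw hx
        (deriv_le_of_deriv_deriv_le hw h0 (fun r hr => (hw2 r hr).1) (norm_nonneg _))
        (hw2 _ (norm_nonneg _)).1 (fun k => pd (ee k) f x)
      rw [← gradNormSq_eq] at h1
      have h2 := mul_le_mul_of_nonneg_right (neg_le_of_abs_le (hΔ x)) (sq_nonneg ‖f x‖)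
      linarith
    · exact Eventually.of_forall fun x => add_nonneg
        (mul_nonneg (by norm_num) (gradNormSq_nonneg _ _)) (by positivity)
  have hnon : ∫ x, ‖x‖ ^ (-b) * ‖f x‖ ^ (p + 1) * virialWeight b p (fun y => w ‖y‖) x ≤
      -8 * κ * (∫ x, ‖x‖ ^ (-b) * ‖f x‖ ^ (p + 1)) +
        (Cm + 8 * κ) * R ^ (-b) * (∫ x, ‖f x‖ ^ (p + 1)) := by
    rw [← integral_const_mul, ← integral_const_mul,
      ← integral_add (i4.const_mul _) (i3.const_mul _)]
    refine integral_mono_ae hI ((i4.const_mul _).add (i3.const_mul _)) ?_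
    filter_upwards [hne] with x hx
    have hx' : 0 < ‖x‖ := by simpa using hx
    change _ ≤ -8 * κ * (‖x‖ ^ (-b) * ‖f x‖ ^ (p + 1)) +
      (Cm + 8 * κ) * R ^ (-b) * ‖f x‖ ^ (p + 1)
    rcases lt_or_ge ‖x‖ R with h | h
    · rw [virialWeight_eq_of_norm_lt hp hw hwr hx h]
      have : 0 ≤ (Cm + 8 * κ) * R ^ (-b) * ‖f x‖ ^ (p + 1) := by positivity
      linarith
    · have h1 := (le_abs_self _).trans (abs_virialWeight_le hN hb hp hw h0
        (fun r hr => (hw2 r hr).2) hx)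
      have h2 : ‖x‖ ^ (-b) ≤ R ^ (-b) :=
        Real.rpow_le_rpow_of_nonpos hR h (by linarith)
      have h3 : ‖x‖ ^ (-b) * ‖f x‖ ^ (p + 1) * (virialWeight b p (fun y => w ‖y‖) x + 8 * κ) ≤
          R ^ (-b) * ‖f x‖ ^ (p + 1) * (Cm + 8 * κ) := by
        refine (mul_le_mul_of_nonneg_left (add_le_add_left h1 (8 * κ)) (by positivity)).trans ?_
        gcongr
      linarith
  have hK : 8 * Kq N b p f = 8 * (∫ x, gradNormSq f x) +
      -8 * κ * (∫ x, ‖x‖ ^ (-b) * ‖f x‖ ^ (p + 1)) := by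
    rw [Kq]; ring
  rw [hK]
  linarith

lemma lt_sub_one_of_subcritical (hN : 1 ≤ N) (hb2 : b < min 2 (N : ℝ)) (hp1 : 1 + 4 / N < p)
    (hp2 : 3 ≤ N → p < 1 + (4 - 2 * b) / ((N : ℝ) - 2)) : b < p - 1 := by
  have hN' : (1 : ℝ) ≤ N := by exact_mod_cast hN
  suffices h : b ≤ 4 / N by linarith
  have hb2' := lt_min_iff.1 hb2
  rw [le_div_iff₀ (by linarith)]
  rcases lt_or_ge N 3 with h | h
  · have h' : (N : ℝ) ≤ 2 := by exact_mod_cast Nat.lt_succ_iff.1 h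
    nlinarith
  · have h' : (3 : ℝ) ≤ N := by exact_mod_cast h
    have h1 : 4 / (N : ℝ) < (4 - 2 * b) / ((N : ℝ) - 2) := by linarith [hp2 h]
    rw [div_lt_div_iff₀ (by linarith) (by linarith)] at h1
    linarith

end VirialEstimate

/-- Virial estimate in the case `1 + 4/N < p < 2*` (so `α = N(p−1)/4 > 1`):
there is `C > 0`, depending only on `N, p, b, δ₀, M₁, C₁, C₃`, such that for every classical
Schwartz solution of (INLS) on an interval `J` satisfying (i) `K(u(t)) ≤ −δ₀‖∇u(t)‖²`,
(ii) `‖u(t)‖² ≤ M₁`, (iii) `‖u(t)‖_{p+1}^{p+1} ≤ C₁‖∇u(t)‖^{2α}`, and every `R > 0` with an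
admissible cutoff `w`, the localized virial quantity `I(t) = ∫ w(|x|)|u(t,·)|² dx` satisfies
`I''(t) ≤ −8δ₀‖∇u(t)‖² + C (R^{-b} ‖∇u(t)‖^{2α} + R^{-2})` on `J`. -/
theorem stmt17 (N : ℕ) (hN : 1 ≤ N) (b p δ₀ M₁ C₁ C₃ : ℝ)
    (hb1 : 0 < b) (hb2 : b < min 2 (N : ℝ))
    (hp1 : 1 + 4 / N < p) (hp2 : 3 ≤ N → p < 1 + (4 - 2 * b) / ((N : ℝ) - 2))
    (hδ : 0 < δ₀) (hM : 0 < M₁) (hC₁ : 0 < C₁) (hC₃ : 0 < C₃) :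
    ∃ C : ℝ, 0 < C ∧
      ∀ (J : Set ℝ), J.OrdConnected → ∀ sol : INLSSolution N b p J,
      (∀ t ∈ J, Kq N b p (fun y => sol.u t y) ≤
        -δ₀ * ∫ x : EuclideanSpace ℝ (Fin N), gradNormSq (fun y => sol.u t y) x) →
      (∀ t ∈ J, ∫ x : EuclideanSpace ℝ (Fin N), ‖sol.u t x‖ ^ 2 ≤ M₁) →
      (∀ t ∈ J, ∫ x : EuclideanSpace ℝ (Fin N), ‖sol.u t x‖ ^ (p + 1) ≤
        C₁ * (∫ x : EuclideanSpace ℝ (Fin N), gradNormSq (fun y => sol.u t y) x) ^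
          ((N : ℝ) * (p - 1) / 4)) →
      ∀ R : ℝ, 0 < R → ∀ w : ℝ → ℝ,
        ContDiff ℝ 4 w →
        (∀ r ∈ Icc (0:ℝ) R, w r = r ^ 2) →
        (∀ r : ℝ, 2 * R ≤ r → w r = 0) →
        (∀ r : ℝ, 0 ≤ r → deriv (deriv w) r ≤ 2 ∧ |deriv (deriv w) r| ≤ C₃) →
        ContDiff ℝ 4 (fun x : EuclideanSpace ℝ (Fin N) => w ‖x‖) →
        (∀ x : EuclideanSpace ℝ (Fin N),
          |lapR (lapR (fun y : EuclideanSpace ℝ (Fin N) => w ‖y‖)) x| ≤ C₃ / R ^ 2) →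
        ∃ I' : ℝ → ℝ,
          (∀ t ∈ J,
            HasDerivWithinAt
              (fun s => ∫ x : EuclideanSpace ℝ (Fin N), w ‖x‖ * ‖sol.u s x‖ ^ 2)
              (I' t) J t) ∧
          (∀ t ∈ J, ∃ d : ℝ, HasDerivWithinAt I' d J t ∧
            d ≤ -8 * δ₀ *
                (∫ x : EuclideanSpace ℝ (Fin N), gradNormSq (fun y => sol.u t y) x) +
              C * (R ^ (-b) *
                  (∫ x : EuclideanSpace ℝ (Fin N), gradNormSq (fun y => sol.u t y) x) ^
                    ((N : ℝ) * (p - 1) / 4) +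
                R ^ (-2 : ℝ))) := by
  have hbp : b < p - 1 := lt_sub_one_of_subcritical hN hb2 hp1 hp2
  have hp : 1 < p := by linarith
  have : NeZero N := ⟨by omega⟩
  set κ := ((N : ℝ) * (p - 1) + 2 * b) / (2 * (p + 1)) with hκ
  set Cm := 4 * b / (p + 1) * C₃ + 2 * (p - 1) / (p + 1) * (N * C₃) with hCm
  have hp0 : 0 ≤ p - 1 := by linarith
  have hκ0 : 0 ≤ κ := by positivity
  have hCm0 : 0 ≤ Cm := by positivity
  refine ⟨(Cm + 8 * κ) * C₁ + C₃ * M₁, by positivity, ?_⟩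
  intro J hJ sol hK hmass hGN R hR w hw hwr hw0 hw2 hφ hΔ
  rcases J.subsingleton_or_nontrivial with hJ' | hJ'
  · exact ⟨0, fun t _ => HasFDerivWithinAt.of_subsingleton hJ', fun t _ =>
      ⟨_, HasFDerivWithinAt.of_subsingleton hJ', le_rfl⟩⟩
  have hc := hasCompactSupport_comp_norm (N := N) hw0
  have hφ2 : ContDiff ℝ 2 fun x : EuclideanSpace ℝ (Fin N) => w ‖x‖ := hφ.of_le (by norm_num)
  refine ⟨_, fun t ht => sol.hasDerivWithinAt_integral_weight hb1 hbp hJ hJ' hφ2 hc ht,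
    fun t ht => ⟨_, sol.hasDerivWithinAt_integral_momentum hb1 hbp hJ hJ' hφ2 hc ht, ?_⟩⟩
  obtain ⟨hI, he⟩ := sol.integral_two_mul_inner_timeDeriv hb1 hbp hJ hJ' hφ hc ht
  obtain ⟨A, L, T, -, -, -, K, -, htK, -, hA, hL, -⟩ :=
    sol.exists_local_bounds hb1 hbp hJ hJ' ht
  rw [he]
  refine (virial_le hN hb1 hbp hR hC₃ (hw.of_le (by norm_num)) hwr hw2 hΔ (sol.u t)
    (norm_le_mul_norm_of_apply_zero _ (hL t htK) (sol.apply_zero hb1 hp hJ hJ' ht))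
    (hA t htK) hI).trans ?_
  have h1 := hK t ht
  have h2 := hmass t ht
  have h3 := hGN t ht
  set G := ∫ x : EuclideanSpace ℝ (Fin N), gradNormSq (fun y => sol.u t y) x
  have hG : 0 ≤ G := integral_nonneg fun x => gradNormSq_nonneg _ x
  have hR2 : R ^ (-2 : ℝ) = (R ^ 2)⁻¹ := by rw [Real.rpow_neg hR.le, Real.rpow_two]
  have h2' : C₃ / R ^ 2 * (∫ x, ‖sol.u t x‖ ^ 2) ≤ C₃ / R ^ 2 * M₁ := by gcongr
  have h3' : (Cm + 8 * κ) * (R ^ (-b) * ∫ x, ‖sol.u t x‖ ^ (p + 1)) ≤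
      (Cm + 8 * κ) * (R ^ (-b) * (C₁ * G ^ ((N : ℝ) * (p - 1) / 4))) := by gcongr
  have h4 : 0 ≤ (Cm + 8 * κ) * C₁ * (R ^ 2)⁻¹ := by positivity
  have h5 : 0 ≤ C₃ * M₁ * (R ^ (-b) * G ^ ((N : ℝ) * (p - 1) / 4)) := by positivity
  rw [hR2]
  rw [div_eq_mul_inv] at h2'
  calc _ ≤ 8 * (-δ₀ * G) + C₃ * (R ^ 2)⁻¹ * M₁ +
        (Cm + 8 * κ) * (R ^ (-b) * (C₁ * G ^ ((N : ℝ) * (p - 1) / 4))) :=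
      add_le_add (add_le_add (mul_le_mul_of_nonneg_left h1 (by norm_num))
        (by rw [div_eq_mul_inv]; exact h2')) h3'
    _ ≤ _ := by linarith
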